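/- arXiv:0712.2471 — 2 statements merged into one kernel-verified Lean document; each statement's English description precedes it below -/
import Mathlib

section
/- Let 0 ≤ q ≤ 1 with 4q(1−q) ≤ 1/2. Then the private classical capacity of the BB84 channel satisfies C_p(N^BB84_q) ≤ H(1/2 − 2q(1−q)) − H(2q(1−q)). -/
open scoped Matrix Kronecker ComplexOrder

/-- A finite family of Kraus operators from input space `A` to output space `B`. -/
structure KrausFamily (A B : Type) [Fintype A] [DecidableEq A] [Fintype B] [DecidableEq B] :
    Type 1 where
  ι : Type
  [fι : Fintype ι]
  [dι : DecidableEq ι]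
  K : ι → Matrix B A ℂ

attribute [instance] KrausFamily.fι KrausFamily.dι

variable {A B : Type} [Fintype A] [DecidableEq A] [Fintype B] [DecidableEq B]

/-- The trace-preservation condition `Σ Kᵢ† Kᵢ = 1` making a Kraus family a quantum channel. -/
def KrausFamily.IsChannel (N : KrausFamily A B) : Prop :=
  ∑ i, (N.K i)ᴴ * N.K i = 1

/-- The action of a channel: `N(ρ) = Σ Kᵢ ρ Kᵢ†`. -/
noncomputable def KrausFamily.apply (N : KrausFamily A B) (ρ : Matrix A A ℂ) : Matrix B B ℂ :=
  ∑ i, N.K i * ρ * (N.K i)ᴴ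

/-- The complementary channel: `N̂(ρ)ᵢⱼ = Tr (Kᵢ ρ Kⱼ†)`. -/
noncomputable def KrausFamily.compl (N : KrausFamily A B) (ρ : Matrix A A ℂ) :
    Matrix N.ι N.ι ℂ :=
  Matrix.of fun i j => (N.K i * ρ * (N.K j)ᴴ).trace

/-- Von Neumann entropy, base 2: `S(ρ) = −Σ λⱼ log₂ λⱼ` over the eigenvalues of `ρ`
(junk value `0` for non-Hermitian matrices). -/
noncomputable def vnEntropy {n : Type} [Fintype n] [DecidableEq n] (ρ : Matrix n n ℂ) : ℝ :=
  if h : ρ.IsHermitian then -∑ j, h.eigenvalues j * Real.logb 2 (h.eigenvalues j) else 0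

/-- A density matrix: positive semidefinite with unit trace. -/
def IsDensity {n : Type} [Fintype n] (ρ : Matrix n n ℂ) : Prop :=
  ρ.PosSemidef ∧ ρ.trace = 1

/-- Coherent information of `N` at input `φ`: `I^c(N,φ) = S(N(φ)) − S(N̂(φ))`. -/
noncomputable def cohInfo (N : KrausFamily A B) (φ : Matrix A A ℂ) : ℝ :=
  vnEntropy (N.apply φ) - vnEntropy (N.compl φ)

/-- One-shot quantum capacity: `Q^{(1)}(N) = sup_φ I^c(N,φ)` over density matrices `φ`. -/
noncomputable def Q1 (N : KrausFamily A B) : ℝ :=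
  sSup {x | ∃ φ : Matrix A A ℂ, IsDensity φ ∧ x = cohInfo N φ}

/-- The `n`-th tensor power of a Kraus family, whose Kraus operators are all `n`-fold
Kronecker products of Kraus operators of `N`. -/
noncomputable def KrausFamily.pow (N : KrausFamily A B) (n : ℕ) :
    KrausFamily (Fin n → A) (Fin n → B) where
  ι := Fin n → N.ι
  K f := Matrix.of fun b a => ∏ i, N.K (f i) (b i) (a i)

/-- Quantum capacity: `Q(N) = sup_{n ≥ 1} (1/n) Q^{(1)}(N^{⊗n})`. -/
noncomputable def Qcap (N : KrausFamily A B) : ℝ :=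
  sSup {x | ∃ n : ℕ, 0 < n ∧ x = (1 / (n : ℝ)) * Q1 (N.pow n)}

/-- `N` is degradable if some channel `D` maps its output to its complementary output. -/
def KrausFamily.IsDegradable (N : KrausFamily A B) : Prop :=
  ∃ D : KrausFamily B N.ι, D.IsChannel ∧ ∀ ρ : Matrix A A ℂ, D.apply (N.apply ρ) = N.compl ρ

/-- `N` is antidegradable if some channel `D` maps its complementary output to its output. -/
def KrausFamily.IsAntidegradable (N : KrausFamily A B) : Prop :=
  ∃ D : KrausFamily N.ι B, D.IsChannel ∧ ∀ ρ : Matrix A A ℂ, D.apply (N.compl ρ) = N.apply ρ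

section Private

variable {A B : Type} [Fintype A] [DecidableEq A] [Fintype B] [DecidableEq B]

/-- The classical–quantum–quantum state
`ω_{TBE} = Σ_{x,t} p(t|x) pₓ |t⟩⟨t|_T ⊗ U|φₓ⟩⟨φₓ|U†`, where `U` is the isometric
extension `U|ψ⟩ = Σᵢ Kᵢ|ψ⟩ ⊗ |i⟩_E` of the channel `N`. -/
noncomputable def privState (N : KrausFamily A B) {nX nT : ℕ}
    (p : Fin nX → ℝ) (φ : Fin nX → (A → ℂ)) (pt : Fin nT → Fin nX → ℝ) :
    Matrix (Fin nT × B × N.ι) (Fin nT × B × N.ι) ℂ :=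
  Matrix.of fun z w =>
    if z.1 = w.1 then
      ∑ x, ((pt z.1 x * p x : ℝ) : ℂ) *
        ((N.K z.2.2 *ᵥ φ x) z.2.1 * star ((N.K w.2.2 *ᵥ φ x) w.2.1))
    else 0

variable {T E : Type} [Fintype T] [Fintype E]

/-- Reduced state on the first two factors of a tripartite system. -/
noncomputable def red12 (ω : Matrix (T × B × E) (T × B × E) ℂ) : Matrix (T × B) (T × B) ℂ :=
  Matrix.of fun z w => ∑ e, ω (z.1, z.2, e) (w.1, w.2, e)

/-- Reduced state on the first and third factors of a tripartite system. -/
noncomputable def red13 (ω : Matrix (T × B × E) (T × B × E) ℂ) : Matrix (T × E) (T × E) ℂ :=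
  Matrix.of fun z w => ∑ b, ω (z.1, b, z.2) (w.1, b, w.2)

/-- Reduced state on the first factor of a tripartite system. -/
noncomputable def red1 (ω : Matrix (T × B × E) (T × B × E) ℂ) : Matrix T T ℂ :=
  Matrix.of fun t t' => ∑ b, ∑ e, ω (t, b, e) (t', b, e)

/-- Reduced state on the second factor of a tripartite system. -/
noncomputable def red2 (ω : Matrix (T × B × E) (T × B × E) ℂ) : Matrix B B ℂ :=
  Matrix.of fun b b' => ∑ t, ∑ e, ω (t, b, e) (t, b', e)

/-- Reduced state on the third factor of a tripartite system. -/
noncomputable def red3 (ω : Matrix (T × B × E) (T × B × E) ℂ) : Matrix E E ℂ :=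
  Matrix.of fun e e' => ∑ t, ∑ b, ω (t, b, e) (t, b, e')

/-- The one-shot private information
`C_p^{(1)}(N) = sup ( I(T;B)_ω − I(T;E)_ω )`, the supremum running over finite ensembles
`{pₓ, |φₓ⟩}` of pure input states and stochastic maps `p(t|x)`, with
`I(T;B)_ω = S(ω_T) + S(ω_B) − S(ω_{TB})` evaluated on the state `ω = privState N p φ pt`. -/
noncomputable def Cp1 (N : KrausFamily A B) : ℝ :=
  sSup {r | ∃ (nX nT : ℕ) (p : Fin nX → ℝ) (φ : Fin nX → (A → ℂ))
      (pt : Fin nT → Fin nX → ℝ),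
    (∀ x, 0 ≤ p x) ∧ (∑ x, p x = 1) ∧
    (∀ x, ∑ a, ‖φ x a‖ ^ 2 = 1) ∧
    (∀ t x, 0 ≤ pt t x) ∧ (∀ x, ∑ t, pt t x = 1) ∧
    r = (vnEntropy (red1 (privState N p φ pt)) + vnEntropy (red2 (privState N p φ pt))
          - vnEntropy (red12 (privState N p φ pt)))
      - (vnEntropy (red1 (privState N p φ pt)) + vnEntropy (red3 (privState N p φ pt))
          - vnEntropy (red13 (privState N p φ pt)))}

/-- The private classical capacity `C_p(N) = sup_{n ≥ 1} (1/n) C_p^{(1)}(N^{⊗n})`. -/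
noncomputable def Cp (N : KrausFamily A B) : ℝ :=
  sSup {x | ∃ n : ℕ, 0 < n ∧ x = (1 / (n : ℝ)) * Cp1 (N.pow n)}

end Private

/-- Pauli `X`. -/
def PauliX : Matrix (Fin 2) (Fin 2) ℂ := !![0, 1; 1, 0]

/-- Pauli `Y`. -/
def PauliY : Matrix (Fin 2) (Fin 2) ℂ := !![0, -Complex.I; Complex.I, 0]

/-- Pauli `Z`. -/
def PauliZ : Matrix (Fin 2) (Fin 2) ℂ := !![1, 0; 0, -1]

/-- The BB84 channel `N^BB84_q(ρ) = (1−q)²ρ + q(1−q)XρX + q(1−q)ZρZ + q²YρY`. -/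
noncomputable def NBB84 (q : ℝ) : KrausFamily (Fin 2) (Fin 2) where
  ι := Fin 4
  K := ![((1 - q : ℝ) : ℂ) • 1,
        ((Real.sqrt (q * (1 - q)) : ℝ) : ℂ) • PauliX,
        ((Real.sqrt (q * (1 - q)) : ℝ) : ℂ) • PauliZ,
        ((q : ℝ) : ℂ) • PauliY]

/-- Binary entropy `H(x) = −x log₂ x − (1−x) log₂ (1−x)`. -/
noncomputable def binEnt (x : ℝ) : ℝ :=
  -x * Real.logb 2 x - (1 - x) * Real.logb 2 (1 - x)

/-- Von Neumann entropy in nats, as a sum over the roots of the characteristic polynomial. -/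
noncomputable def natEntropy {n : Type} [Fintype n] [DecidableEq n] (ρ : Matrix n n ℂ) : ℝ :=
  (ρ.charpoly.roots.map fun z => Real.negMulLog z.re).sum

section Entropy

variable {m n : Type} [Fintype m] [DecidableEq m] [Fintype n] [DecidableEq n]

theorem natEntropy_eq_sum_eigenvalues {ρ : Matrix n n ℂ} (h : ρ.IsHermitian) :
    natEntropy ρ = ∑ j, Real.negMulLog (h.eigenvalues j) := by
  simp [natEntropy, h.roots_charpoly_eq_eigenvalues, Multiset.map_map]

theorem vnEntropy_eq_natEntropy_div {ρ : Matrix n n ℂ} (h : ρ.IsHermitian) :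
    vnEntropy ρ = natEntropy ρ / Real.log 2 := by
  rw [vnEntropy, dif_pos h, natEntropy_eq_sum_eigenvalues h, Finset.sum_div, ← Finset.sum_neg_distrib]
  refine Finset.sum_congr rfl fun j _ => ?_
  simp only [Real.negMulLog, Real.logb]
  ring

theorem natEntropy_mul_comm (M : Matrix m n ℂ) (N : Matrix n m ℂ) :
    natEntropy (M * N) = natEntropy (N * M) := by
  have h := congrArg (fun p => (p.roots.map fun z => Real.negMulLog z.re).sum)
    (Matrix.charpoly_mul_comm' M N)
  have hne : ∀ (k : ℕ) (p : Polynomial ℂ), p.Monic → (Polynomial.X ^ k * p) ≠ 0 := fun k p hp =>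
    mul_ne_zero (pow_ne_zero _ Polynomial.X_ne_zero) hp.ne_zero
  simpa [natEntropy, Polynomial.roots_mul (hne _ _ (Matrix.charpoly_monic _)),
    Multiset.map_nsmul, Multiset.sum_nsmul] using h

theorem natEntropy_transpose (M : Matrix n n ℂ) : natEntropy Mᵀ = natEntropy M := by
  rw [natEntropy, Matrix.charpoly_transpose, natEntropy]

theorem natEntropy_diagonal (d : n → ℝ) :
    natEntropy (Matrix.diagonal fun i => (d i : ℂ)) = ∑ i, Real.negMulLog (d i) := by
  rw [natEntropy, Matrix.charpoly_diagonal, Polynomial.roots_prod]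
  · simp
  · simp [Finset.prod_ne_zero_iff, Polynomial.X_sub_C_ne_zero]

theorem charpoly_blockDiagonal (σ : m → Matrix n n ℂ) :
    (Matrix.blockDiagonal σ).charpoly = ∏ t, (σ t).charpoly := by
  have : (Matrix.blockDiagonal σ).charmatrix = Matrix.blockDiagonal fun t => (σ t).charmatrix := by
    ext ⟨i, t⟩ ⟨j, s⟩ : 1
    simp only [Matrix.charmatrix_apply, Matrix.blockDiagonal_apply, Matrix.diagonal_apply,
      Prod.mk.injEq]
    by_cases h : t = s <;> simp [h]
  simp only [Matrix.charpoly, this, Matrix.det_blockDiagonal]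

theorem natEntropy_block (σ : m → Matrix n n ℂ) :
    natEntropy (Matrix.of fun z w : m × n => if z.1 = w.1 then σ z.1 z.2 w.2 else 0) =
      ∑ t, natEntropy (σ t) := by
  have : (Matrix.of fun z w : m × n => if z.1 = w.1 then σ z.1 z.2 w.2 else 0) =
      Matrix.reindex (Equiv.prodComm n m) (Equiv.prodComm n m) (Matrix.blockDiagonal σ) := by
    ext ⟨t, i⟩ ⟨s, j⟩
    simp [Matrix.blockDiagonal_apply]
  rw [natEntropy, this, Matrix.charpoly_reindex, charpoly_blockDiagonal, Polynomial.roots_prod]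
  · simp [natEntropy, Multiset.map_bind, Multiset.sum_bind]
  · exact Finset.prod_ne_zero_iff.2 fun t _ => (Matrix.charpoly_monic _).ne_zero

end Entropy

section RelativeEntropy

open MeasureTheory intervalIntegral

theorem intervalIntegrable_and_integral_kernel {p s : ℝ} (hp : 0 ≤ p) (hs : 0 < s) :
    IntervalIntegrable (fun u => u * ((p - s) ^ 2 / ((1 - u) * p + u * s))) volume 0 1 ∧
      ∫ u in (0 : ℝ)..1, u * ((p - s) ^ 2 / ((1 - u) * p + u * s)) =
        p * Real.log p - p * Real.log s - p + s := by
  rcases hp.eq_or_lt with rfl | hp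
  · have h : ∀ u ∈ Set.uIoc (0 : ℝ) 1, s = u * ((0 - s) ^ 2 / ((1 - u) * 0 + u * s)) := by
      intro u hu
      rw [Set.uIoc_of_le zero_le_one] at hu
      have := hu.1.ne'
      field_simp
      simp
      ring
    refine ⟨(intervalIntegrable_const (c := s)).congr h, ?_⟩
    rw [← integral_congr_ae (f := fun _ => s) (Filter.Eventually.of_forall h)]
    simp
  · have hpos : ∀ u ∈ Set.uIcc (0 : ℝ) 1, 0 < (1 - u) * p + u * s := by
      intro u hu
      rw [Set.uIcc_of_le zero_le_one] at hu
      rcases hu.1.eq_or_lt with rfl | h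
      · simpa using hp
      · have := mul_pos h hs
        have := mul_nonneg (sub_nonneg.2 hu.2) hp.le
        linarith
    have hInt : IntervalIntegrable (fun u => u * ((p - s) ^ 2 / ((1 - u) * p + u * s)))
        volume 0 1 := by
      refine ContinuousOn.intervalIntegrable ?_
      refine continuousOn_id.mul (continuousOn_const.div (by fun_prop) fun u hu => (hpos u hu).ne')
    refine ⟨hInt, ?_⟩
    rw [integral_eq_sub_of_hasDerivAt
      (f := fun u => (s - p) * u - p * Real.log ((1 - u) * p + u * s)) (fun u hu => ?_) hInt]
    · simp
      ring
    · have hd : HasDerivAt (fun u : ℝ => (1 - u) * p + u * s) ((0 - 1) * p + 1 * s) u :=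
        (((hasDerivAt_const u (1 : ℝ)).sub (hasDerivAt_id u)).mul_const p).add
          ((hasDerivAt_id u).mul_const s)
      have hne := (hpos u hu).ne'
      refine (((hasDerivAt_id u).const_mul (s - p)).sub ((hd.log hne).const_mul p)).congr_deriv ?_
      clear hd
      generalize hd : (1 - u) * p + u * s = d at hne ⊢
      field_simp
      rw [← hd]
      ring

theorem intervalIntegrable_and_integral_weighted_kernel {c p s : ℝ} (hp : 0 ≤ p) (hs : 0 ≤ s)
    (hc : s = 0 → c * p = 0) :
    IntervalIntegrable (fun u => u * (c * ((p - s) ^ 2 / ((1 - u) * p + u * s)))) volume 0 1 ∧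
      ∫ u in (0 : ℝ)..1, u * (c * ((p - s) ^ 2 / ((1 - u) * p + u * s))) =
        c * (p * Real.log p - p * Real.log s - p + s) := by
  rcases hs.eq_or_lt with rfl | hs
  · rcases mul_eq_zero.1 (hc rfl) with rfl | rfl <;> simp
  · obtain ⟨h1, h2⟩ := intervalIntegrable_and_integral_kernel hp hs
    have : (fun u => u * (c * ((p - s) ^ 2 / ((1 - u) * p + u * s)))) =
        fun u => c * (u * ((p - s) ^ 2 / ((1 - u) * p + u * s))) := by
      ext u; ring
    rw [this]
    exact ⟨h1.const_mul c, by rw [intervalIntegral.integral_const_mul, h2]⟩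

variable {m n τ : Type} [Fintype m] [DecidableEq m] [Fintype n] [DecidableEq n] [Fintype τ]

theorem Matrix.PosSemidef.exists_spectral {ρ : Matrix n n ℂ} (h : ρ.PosSemidef) :
    ∃ (U : Matrix n n ℂ) (p : n → ℝ), Uᴴ * U = 1 ∧ U * Uᴴ = 1 ∧ (∀ i, 0 ≤ p i) ∧
      ρ = U * Matrix.diagonal (fun i => (p i : ℂ)) * Uᴴ ∧
      natEntropy ρ = ∑ i, Real.negMulLog (p i) := by
  refine ⟨h.isHermitian.eigenvectorUnitary, h.isHermitian.eigenvalues, ?_, ?_,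
    h.eigenvalues_nonneg, ?_, natEntropy_eq_sum_eigenvalues _⟩
  · exact Unitary.coe_star_mul_self _
  · exact Unitary.coe_mul_star_self _
  · exact h.isHermitian.spectral_theorem

/-- A quadratic functional whose maximum over `X`, integrated over `u`, gives the quantum
relative entropy. -/
noncomputable def relFunctional (u : ℝ) (ρ σ X : Matrix n n ℂ) : ℝ :=
  2 * (Xᴴ * ρ - Xᴴ * σ).trace.re - (1 - u) * (Xᴴ * ρ * X).trace.re - u * (X * σ * Xᴴ).trace.re

theorem relFunctional_spectral (u : ℝ) {U V : Matrix n n ℂ} {p s : n → ℝ}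
    (hU : U * Uᴴ = 1) (hV : V * Vᴴ = 1) (Y : Matrix n n ℂ) :
    relFunctional u (U * Matrix.diagonal (fun i => (p i : ℂ)) * Uᴴ)
      (V * Matrix.diagonal (fun i => (s i : ℂ)) * Vᴴ) (U * Y * Vᴴ) =
    ∑ i, ∑ j, (2 * (p i - s j) * (star (Y i j) * (Uᴴ * V) i j).re -
      ((1 - u) * p i + u * s j) * Complex.normSq (Y i j)) := by
  have hU' : Uᴴ * U = 1 := mul_eq_one_comm.1 hU
  have hV' : Vᴴ * V = 1 := mul_eq_one_comm.1 hV
  set P := Matrix.diagonal fun i => (p i : ℂ) with hP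
  set S := Matrix.diagonal fun i => (s i : ℂ) with hS
  have h1 : ((U * Y * Vᴴ)ᴴ * (U * P * Uᴴ)).trace = (Yᴴ * P * (Uᴴ * V)).trace := by
    calc _ = (V * (Yᴴ * (Uᴴ * U) * P * Uᴴ)).trace := by
          simp only [Matrix.conjTranspose_mul, Matrix.conjTranspose_conjTranspose, Matrix.mul_assoc]
      _ = _ := by rw [hU', Matrix.trace_mul_comm]; simp only [Matrix.mul_one, Matrix.mul_assoc]
  have h2 : ((U * Y * Vᴴ)ᴴ * (V * S * Vᴴ)).trace = (Yᴴ * (Uᴴ * V * S)).trace := by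
    calc _ = (V * (Yᴴ * (Uᴴ * V * S) * Vᴴ)).trace := by
          simp only [Matrix.conjTranspose_mul, Matrix.conjTranspose_conjTranspose, Matrix.mul_assoc]
      _ = _ := by rw [Matrix.trace_mul_comm, Matrix.mul_assoc, hV', Matrix.mul_one]
  have h3 : ((U * Y * Vᴴ)ᴴ * (U * P * Uᴴ) * (U * Y * Vᴴ)).trace = (Yᴴ * P * Y).trace := by
    calc _ = (V * (Yᴴ * (Uᴴ * U) * P * (Uᴴ * U) * Y * Vᴴ)).trace := by
          simp only [Matrix.conjTranspose_mul, Matrix.conjTranspose_conjTranspose, Matrix.mul_assoc]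
      _ = _ := by rw [hU', Matrix.trace_mul_comm, Matrix.mul_assoc, hV']; simp only [Matrix.mul_one]
  have h4 : ((U * Y * Vᴴ) * (V * S * Vᴴ) * (U * Y * Vᴴ)ᴴ).trace = (Y * S * Yᴴ).trace := by
    calc _ = (U * (Y * (Vᴴ * V) * S * (Vᴴ * V) * Yᴴ * Uᴴ)).trace := by
          simp only [Matrix.conjTranspose_mul, Matrix.conjTranspose_conjTranspose, Matrix.mul_assoc]
      _ = _ := by rw [hV', Matrix.trace_mul_comm, Matrix.mul_assoc, hU']; simp only [Matrix.mul_one]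
  rw [relFunctional, Matrix.trace_sub, h1, h2, h3, h4]
  have e1 : (Yᴴ * P * (Uᴴ * V)).trace.re = ∑ i, ∑ j, p i * (star (Y i j) * (Uᴴ * V) i j).re := by
    rw [Finset.sum_comm, Matrix.trace, Complex.re_sum]
    refine Finset.sum_congr rfl fun j _ => ?_
    rw [Matrix.diag_apply, Matrix.mul_apply, Complex.re_sum]
    refine Finset.sum_congr rfl fun i _ => ?_
    rw [hP, Matrix.mul_diagonal, Matrix.conjTranspose_apply, mul_right_comm, mul_comm,
      Complex.re_ofReal_mul]
  have e2 : (Yᴴ * (Uᴴ * V * S)).trace.re = ∑ i, ∑ j, s j * (star (Y i j) * (Uᴴ * V) i j).re := by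
    rw [Finset.sum_comm, Matrix.trace, Complex.re_sum]
    refine Finset.sum_congr rfl fun j _ => ?_
    rw [Matrix.diag_apply, Matrix.mul_apply, Complex.re_sum]
    refine Finset.sum_congr rfl fun i _ => ?_
    rw [hS, Matrix.mul_diagonal, Matrix.conjTranspose_apply, ← mul_assoc, mul_comm,
      Complex.re_ofReal_mul]
  have e3 : (Yᴴ * P * Y).trace.re = ∑ i, ∑ j, p i * Complex.normSq (Y i j) := by
    rw [Finset.sum_comm, Matrix.trace, Complex.re_sum]
    refine Finset.sum_congr rfl fun j _ => ?_
    rw [Matrix.diag_apply, Matrix.mul_apply, Complex.re_sum]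
    refine Finset.sum_congr rfl fun i _ => ?_
    rw [hP, Matrix.mul_diagonal, Matrix.conjTranspose_apply, mul_right_comm, mul_comm,
      Complex.re_ofReal_mul]
    simp [Complex.normSq_apply]
  have e4 : (Y * S * Yᴴ).trace.re = ∑ i, ∑ j, s j * Complex.normSq (Y i j) := by
    rw [Matrix.trace, Complex.re_sum]
    refine Finset.sum_congr rfl fun i _ => ?_
    rw [Matrix.diag_apply, Matrix.mul_apply, Complex.re_sum]
    refine Finset.sum_congr rfl fun j _ => ?_
    rw [hS, Matrix.mul_diagonal, Matrix.conjTranspose_apply, mul_right_comm, mul_comm,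
      Complex.re_ofReal_mul]
    simp [Complex.normSq_apply]
  rw [Complex.sub_re, e1, e2, e3, e4]
  simp only [Finset.mul_sum, ← Finset.sum_sub_distrib]
  refine Finset.sum_congr rfl fun i _ => Finset.sum_congr rfl fun j _ => ?_
  ring

theorem quadratic_le (a d : ℝ) (hd : 0 ≤ d) (hda : d = 0 → a = 0) (y c : ℂ) :
    2 * a * (star y * c).re - d * Complex.normSq y ≤ Complex.normSq c * (a ^ 2 / d) := by
  rcases hd.eq_or_lt with rfl | hd
  · simp [hda rfl]
  · have h : 0 ≤ Complex.normSq ((a : ℂ) * c - d * y) := Complex.normSq_nonneg _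
    rw [← mul_div_assoc, le_div_iff₀ hd]
    simp [Complex.normSq_apply] at h ⊢
    nlinarith

theorem quadratic_eq (a d : ℝ) (c : ℂ) :
    2 * a * (star (((a / d : ℝ) : ℂ) * c) * c).re - d * Complex.normSq (((a / d : ℝ) : ℂ) * c) =
      Complex.normSq c * (a ^ 2 / d) := by
  by_cases hd : d = 0
  · simp [hd]
  · simp only [Complex.normSq_apply, Complex.star_def, map_mul, Complex.conj_ofReal, Complex.mul_re,
      Complex.conj_re, Complex.conj_im, Complex.ofReal_re, Complex.ofReal_im, Complex.mul_im]
    field_simp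
    ring

theorem isGreatest_relFunctional {u : ℝ} (hu : u ∈ Set.Ioo (0 : ℝ) 1) {U V : Matrix n n ℂ}
    {p s : n → ℝ} (hU : U * Uᴴ = 1) (hV : V * Vᴴ = 1) (hp : ∀ i, 0 ≤ p i) (hs : ∀ i, 0 ≤ s i) :
    IsGreatest (Set.range (relFunctional u (U * Matrix.diagonal (fun i => (p i : ℂ)) * Uᴴ)
      (V * Matrix.diagonal (fun i => (s i : ℂ)) * Vᴴ)))
    (∑ i, ∑ j, Complex.normSq ((Uᴴ * V) i j) *
      ((p i - s j) ^ 2 / ((1 - u) * p i + u * s j))) := by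
  have h0 : 0 < 1 - u := sub_pos.2 hu.2
  constructor
  · refine ⟨U * (Matrix.of fun i j => (((p i - s j) / ((1 - u) * p i + u * s j) : ℝ) : ℂ) *
      (Uᴴ * V) i j) * Vᴴ, ?_⟩
    rw [relFunctional_spectral u hU hV]
    refine Finset.sum_congr rfl fun i _ => Finset.sum_congr rfl fun j _ => ?_
    exact quadratic_eq _ _ _
  · rintro _ ⟨X, rfl⟩
    have hX : X = U * (Uᴴ * X * V) * Vᴴ := by
      calc X = (U * Uᴴ) * X * (V * Vᴴ) := by simp [hU, hV]
        _ = _ := by simp only [Matrix.mul_assoc]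
    rw [hX, relFunctional_spectral u hU hV]
    refine Finset.sum_le_sum fun i _ => Finset.sum_le_sum fun j _ => ?_
    have h1 := mul_nonneg h0.le (hp i)
    have h2 := mul_nonneg hu.1.le (hs j)
    refine quadratic_le _ _ (add_nonneg h1 h2) (fun h => ?_) _ _
    have h3 : (1 - u) * p i = 0 := by linarith
    have h4 : u * s j = 0 := by linarith
    rw [(mul_eq_zero.1 h3).resolve_left h0.ne', (mul_eq_zero.1 h4).resolve_left hu.1.ne', sub_self]

theorem sum_normSq_row {W : Matrix n n ℂ} (h : W * Wᴴ = 1) (i : n) :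
    ∑ j, Complex.normSq (W i j) = 1 := by
  have := congrFun (congrFun h i) i
  simp only [Matrix.mul_apply, Matrix.conjTranspose_apply, Matrix.one_apply_eq] at this
  have h2 := congrArg Complex.re this
  simpa [Complex.normSq_apply] using h2

theorem sum_normSq_col {W : Matrix n n ℂ} (h : Wᴴ * W = 1) (j : n) :
    ∑ i, Complex.normSq (W i j) = 1 := by
  have := congrFun (congrFun h j) j
  simp only [Matrix.mul_apply, Matrix.conjTranspose_apply, Matrix.one_apply_eq] at this
  have h2 := congrArg Complex.re this
  simpa [Complex.normSq_apply] using h2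


theorem exists_integral_relFunctional {ρ : τ → Matrix n n ℂ} (hρ : ∀ t, (ρ t).PosSemidef) :
    ∃ g : τ → ℝ → ℝ,
      (∀ u ∈ Set.Ioo (0 : ℝ) 1, ∀ t,
        IsGreatest (Set.range (relFunctional u (ρ t) (∑ t, ρ t))) (g t u)) ∧
      (∀ t, IntervalIntegrable (fun u => u * g t u) volume 0 1) ∧
      natEntropy (∑ t, ρ t) - ∑ t, natEntropy (ρ t) =
        ∑ t, ((ρ t).trace.re - (∑ t, ρ t).trace.re) + ∑ t, ∫ u in (0 : ℝ)..1, u * g t u := by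
  set σ := ∑ t, ρ t with hσ
  have hσp : σ.PosSemidef := Matrix.posSemidef_sum _ fun t _ => hρ t
  choose U p hU hU' hp hpρ hpS using fun t => (hρ t).exists_spectral
  obtain ⟨V, s, hV, hV', hs, hsσ, hsS⟩ := hσp.exists_spectral
  set c : τ → n → n → ℝ := fun t i j => Complex.normSq (((U t)ᴴ * V) i j) with hc
  have hW : ∀ t, ((U t)ᴴ * V) * ((U t)ᴴ * V)ᴴ = 1 := fun t => by
    calc _ = (U t)ᴴ * (V * Vᴴ) * U t := by
          simp only [Matrix.conjTranspose_mul, Matrix.conjTranspose_conjTranspose, Matrix.mul_assoc]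
      _ = 1 := by rw [hV', Matrix.mul_one, hU]
  have hW' : ∀ t, ((U t)ᴴ * V)ᴴ * ((U t)ᴴ * V) = 1 := fun t => mul_eq_one_comm.1 (hW t)
  have hrow : ∀ t i, ∑ j, c t i j = 1 := fun t => sum_normSq_row (hW t)
  have hcol : ∀ t j, ∑ i, c t i j = 1 := fun t => sum_normSq_col (hW' t)
  have hdiag : ∀ t j, ((Vᴴ * ρ t * V) j j).re = ∑ i, c t i j * p t i := by
    intro t j
    have : Vᴴ * ρ t * V = ((U t)ᴴ * V)ᴴ * Matrix.diagonal (fun i => (p t i : ℂ)) *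
        ((U t)ᴴ * V) := by
      rw [hpρ t]
      simp only [Matrix.conjTranspose_mul, Matrix.conjTranspose_conjTranspose, Matrix.mul_assoc]
    rw [this, Matrix.mul_apply, Complex.re_sum]
    refine Finset.sum_congr rfl fun i _ => ?_
    rw [Matrix.mul_diagonal, Matrix.conjTranspose_apply, mul_right_comm, mul_comm,
      Complex.re_ofReal_mul]
    simp [hc, Complex.normSq_apply, mul_comm]
  have hsum : ∀ j, ∑ t, ∑ i, c t i j * p t i = s j := by
    intro j
    simp only [← hdiag]
    rw [← Complex.re_sum, ← Matrix.sum_apply, ← Finset.sum_mul, ← Finset.mul_sum, ← hσ, hsσ]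
    have : Vᴴ * (V * Matrix.diagonal (fun i => (s i : ℂ)) * Vᴴ) * V =
        (Vᴴ * V) * Matrix.diagonal (fun i => (s i : ℂ)) * (Vᴴ * V) := by
      simp only [Matrix.mul_assoc]
    rw [this, hV, Matrix.one_mul, Matrix.mul_one, Matrix.diagonal_apply_eq, Complex.ofReal_re]
  have hcp : ∀ t i j, 0 ≤ c t i j * p t i := fun t i j =>
    mul_nonneg (Complex.normSq_nonneg _) (hp t i)
  have hsupp : ∀ t i j, s j = 0 → c t i j * p t i = 0 := by
    intro t i j h
    have h1 := (Finset.sum_eq_zero_iff_of_nonneg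
      fun t _ => Finset.sum_nonneg fun i _ => hcp t i j).1 ((hsum j).trans h) t (Finset.mem_univ _)
    exact (Finset.sum_eq_zero_iff_of_nonneg fun i _ => hcp t i j).1 h1 i (Finset.mem_univ _)
  have hk := fun t i j =>
    intervalIntegrable_and_integral_weighted_kernel (hp t i) (hs j) (hsupp t i j)
  have hInt : ∀ t i, IntervalIntegrable (fun u => ∑ j, u * (c t i j *
      ((p t i - s j) ^ 2 / ((1 - u) * p t i + u * s j)))) volume 0 1 := fun t i => by
    simpa only [Finset.sum_fn] using
      IntervalIntegrable.sum Finset.univ fun j _ => (hk t i j).1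
  refine ⟨fun t u => ∑ i, ∑ j, c t i j * ((p t i - s j) ^ 2 / ((1 - u) * p t i + u * s j)),
    fun u hu t => ?_, fun t => ?_, ?_⟩
  · have := isGreatest_relFunctional hu (hU' t) hV' (hp t) hs
    rwa [← hpρ t, ← hsσ] at this
  · simp only [Finset.mul_sum]
    simpa only [Finset.sum_fn] using IntervalIntegrable.sum Finset.univ fun i _ => hInt t i
  · have hval : ∀ t, ∫ u in (0 : ℝ)..1, u * ∑ i, ∑ j, c t i j *
        ((p t i - s j) ^ 2 / ((1 - u) * p t i + u * s j)) =
        ∑ i, ∑ j, c t i j * (p t i * Real.log (p t i) - p t i * Real.log (s j) - p t i + s j) := by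
      intro t
      simp only [Finset.mul_sum]
      rw [intervalIntegral.integral_finsetSum fun i _ => hInt t i]
      refine Finset.sum_congr rfl fun i _ => ?_
      rw [intervalIntegral.integral_finsetSum fun j _ => (hk t i j).1]
      exact Finset.sum_congr rfl fun j _ => (hk t i j).2
    have htr : ∀ t, (ρ t).trace.re = ∑ i, p t i := by
      intro t
      conv_lhs => rw [hpρ t]
      rw [Matrix.trace_mul_comm, ← Matrix.mul_assoc, hU, Matrix.one_mul, Matrix.trace_diagonal,
        Complex.re_sum]
      simp
    have htrσ : σ.trace.re = ∑ i, s i := by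
      conv_lhs => rw [hsσ]
      rw [Matrix.trace_mul_comm, ← Matrix.mul_assoc, hV, Matrix.one_mul, Matrix.trace_diagonal,
        Complex.re_sum]
      simp
    have hval' : ∀ t, ∑ i, ∑ j,
        c t i j * (p t i * Real.log (p t i) - p t i * Real.log (s j) - p t i + s j) =
        -natEntropy (ρ t) - ∑ j, (∑ i, c t i j * p t i) * Real.log (s j) - (ρ t).trace.re +
          σ.trace.re := by
      intro t
      have a1 : ∑ i, ∑ j, c t i j * (p t i * Real.log (p t i)) = -natEntropy (ρ t) := by
        simp only [← Finset.sum_mul, hrow, one_mul, hpS, Real.negMulLog, neg_mul,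
          Finset.sum_neg_distrib, neg_neg]
      have a2 : ∑ i, ∑ j, c t i j * (p t i * Real.log (s j)) =
          ∑ j, (∑ i, c t i j * p t i) * Real.log (s j) := by
        rw [Finset.sum_comm]
        simp only [Finset.sum_mul, mul_assoc]
      have a3 : ∑ i, ∑ j, c t i j * p t i = (ρ t).trace.re := by
        simp only [← Finset.sum_mul, hrow, one_mul, htr]
      have a4 : ∑ i, ∑ j, c t i j * s j = σ.trace.re := by
        rw [Finset.sum_comm]
        simp only [← Finset.sum_mul, hcol, one_mul, htrσ]
      rw [← a1, ← a2, ← a3, ← a4]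
      simp only [mul_add, mul_sub, Finset.sum_add_distrib, Finset.sum_sub_distrib]
    have hlog : ∑ t, ∑ j, (∑ i, c t i j * p t i) * Real.log (s j) = -natEntropy σ := by
      rw [Finset.sum_comm]
      simp only [← Finset.sum_mul, hsum, hsS, Real.negMulLog, neg_mul, Finset.sum_neg_distrib,
        neg_neg]
    simp only [hval, hval', Finset.sum_add_distrib, Finset.sum_sub_distrib,
      Finset.sum_neg_distrib, hlog]
    ring

end RelativeEntropy

section DataProcessing

variable {F G κ τ : Type} [Fintype F] [Fintype G] [Fintype κ] [Fintype τ]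

theorem trace_conj_adjoint_le {L : κ → Matrix B A ℂ} (hL : ∑ k, (L k)ᴴ * L k = 1)
    (Y : κ → Matrix B B ℂ) {ρ : Matrix A A ℂ} (hρ : ρ.PosSemidef) :
    ((∑ k, (L k)ᴴ * Y k * L k)ᴴ * ρ * (∑ k, (L k)ᴴ * Y k * L k)).trace.re ≤
      ∑ k, ((Y k)ᴴ * (L k * ρ * (L k)ᴴ) * Y k).trace.re := by
  set X := ∑ k, (L k)ᴴ * Y k * L k with hX
  have hnonneg : 0 ≤ ∑ k, (((Y k)ᴴ * L k - L k * Xᴴ) * ρ *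
      ((Y k)ᴴ * L k - L k * Xᴴ)ᴴ).trace.re :=
    Finset.sum_nonneg fun k _ =>
      (Complex.le_def.1 (hρ.mul_mul_conjTranspose_same _).trace_nonneg).1
  have hexp : ∀ k, (((Y k)ᴴ * L k - L k * Xᴴ) * ρ * ((Y k)ᴴ * L k - L k * Xᴴ)ᴴ).trace =
      ((Y k)ᴴ * (L k * ρ * (L k)ᴴ) * Y k).trace - ((L k)ᴴ * (Y k)ᴴ * L k * (ρ * X)).trace -
      (Xᴴ * ρ * ((L k)ᴴ * Y k * L k)).trace + (((L k)ᴴ * L k) * (Xᴴ * ρ * X)).trace := by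
    intro k
    have b1 : ((Y k)ᴴ * L k * ρ * (X * (L k)ᴴ)).trace =
        ((L k)ᴴ * (Y k)ᴴ * L k * (ρ * X)).trace := by
      rw [← Matrix.mul_assoc, Matrix.trace_mul_comm]
      simp only [Matrix.mul_assoc]
    have b2 : (L k * Xᴴ * ρ * ((L k)ᴴ * Y k)).trace =
        (Xᴴ * ρ * ((L k)ᴴ * Y k * L k)).trace := by
      rw [Matrix.mul_assoc, Matrix.mul_assoc, Matrix.trace_mul_comm]
      simp only [Matrix.mul_assoc]
    have b3 : (L k * Xᴴ * ρ * (X * (L k)ᴴ)).trace =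
        (((L k)ᴴ * L k) * (Xᴴ * ρ * X)).trace := by
      rw [← Matrix.mul_assoc, Matrix.trace_mul_comm]
      simp only [Matrix.mul_assoc]
    rw [← b1, ← b2, ← b3]
    simp only [Matrix.conjTranspose_sub, Matrix.conjTranspose_mul,
      Matrix.conjTranspose_conjTranspose, Matrix.sub_mul, Matrix.mul_sub, Matrix.trace_sub,
      Matrix.mul_assoc]
    ring
  have c1 : ∑ k, ((L k)ᴴ * (Y k)ᴴ * L k * (ρ * X)).trace = (Xᴴ * ρ * X).trace := by
    rw [← Matrix.trace_sum, ← Finset.sum_mul, Matrix.mul_assoc Xᴴ, hX, Matrix.conjTranspose_sum]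
    simp only [Matrix.conjTranspose_mul, Matrix.conjTranspose_conjTranspose, Matrix.mul_assoc]
  have c2 : ∑ k, (Xᴴ * ρ * ((L k)ᴴ * Y k * L k)).trace = (Xᴴ * ρ * X).trace := by
    rw [← Matrix.trace_sum, ← Finset.mul_sum]
  have c3 : ∑ k, (((L k)ᴴ * L k) * (Xᴴ * ρ * X)).trace = (Xᴴ * ρ * X).trace := by
    rw [← Matrix.trace_sum, ← Finset.sum_mul, hL, Matrix.one_mul]
  simp only [hexp] at hnonneg
  rw [← Complex.re_sum, Finset.sum_add_distrib, Finset.sum_sub_distrib, Finset.sum_sub_distrib,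
    c1, c2, c3] at hnonneg
  rw [← Complex.re_sum]
  simp only [Complex.add_re, Complex.sub_re] at hnonneg
  linarith

theorem sum_relFunctional_le {L : G → F → κ → Matrix B A ℂ}
    (hL : ∀ f, ∑ g, ∑ k, (L g f k)ᴴ * L g f k = 1) {u : ℝ} (hu : u ∈ Set.Ioo (0 : ℝ) 1)
    {ρ σ : F → Matrix A A ℂ} (hρ : ∀ f, (ρ f).PosSemidef) (hσ : ∀ f, (σ f).PosSemidef)
    (Y : G → Matrix B B ℂ) :
    ∑ g, relFunctional u (∑ f, ∑ k, L g f k * ρ f * (L g f k)ᴴ)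
      (∑ f, ∑ k, L g f k * σ f * (L g f k)ᴴ) (Y g) ≤
    ∑ f, relFunctional u (ρ f) (σ f) (∑ g, ∑ k, (L g f k)ᴴ * Y g * L g f k) := by
  have hL' : ∀ f, ∑ x : G × κ, (L x.1 f x.2)ᴴ * L x.1 f x.2 = 1 := fun f => by
    rw [Fintype.sum_prod_type]; exact hL f
  have hq1 := fun f => trace_conj_adjoint_le (hL' f) (fun x => Y x.1) (hρ f)
  have hq2 := fun f => trace_conj_adjoint_le (hL' f) (fun x => (Y x.1)ᴴ) (hσ f)
  simp only [Fintype.sum_prod_type] at hq1 hq2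
  have hlin : ∀ (f : F) (ω : Matrix A A ℂ),
      ((∑ g, ∑ k, (L g f k)ᴴ * Y g * L g f k)ᴴ * ω).trace.re =
        ∑ g, ∑ k, ((Y g)ᴴ * (L g f k * ω * (L g f k)ᴴ)).trace.re := by
    intro f ω
    simp only [Matrix.conjTranspose_sum, Finset.sum_mul, Matrix.trace_sum, Complex.re_sum]
    refine Finset.sum_congr rfl fun g _ => Finset.sum_congr rfl fun k _ => ?_
    congr 1
    simp only [Matrix.conjTranspose_mul, Matrix.conjTranspose_conjTranspose]
    rw [Matrix.mul_assoc, Matrix.trace_mul_comm]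
    simp only [Matrix.mul_assoc]
  have hX : ∀ f, (∑ g, ∑ k, (L g f k)ᴴ * (Y g)ᴴ * L g f k) =
      (∑ g, ∑ k, (L g f k)ᴴ * Y g * L g f k)ᴴ := fun f => by
    simp only [Matrix.conjTranspose_sum, Matrix.conjTranspose_mul,
      Matrix.conjTranspose_conjTranspose, Matrix.mul_assoc]
  simp only [hX, Matrix.conjTranspose_conjTranspose] at hq2
  have hB : ∀ g, relFunctional u (∑ f, ∑ k, L g f k * ρ f * (L g f k)ᴴ)
      (∑ f, ∑ k, L g f k * σ f * (L g f k)ᴴ) (Y g) = ∑ f, (2 * (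
        ∑ k, ((Y g)ᴴ * (L g f k * ρ f * (L g f k)ᴴ)).trace.re -
        ∑ k, ((Y g)ᴴ * (L g f k * σ f * (L g f k)ᴴ)).trace.re)
        - (1 - u) * ∑ k, ((Y g)ᴴ * (L g f k * ρ f * (L g f k)ᴴ) * Y g).trace.re
        - u * ∑ k, (Y g * (L g f k * σ f * (L g f k)ᴴ) * (Y g)ᴴ).trace.re) := by
    intro g
    simp only [relFunctional, Finset.mul_sum, Finset.sum_mul, Matrix.trace_sub, Matrix.trace_sum,
      Complex.sub_re, Complex.re_sum, Finset.sum_sub_distrib, mul_sub]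
  simp only [hB]
  rw [Finset.sum_comm]
  refine Finset.sum_le_sum fun f _ => ?_
  rw [relFunctional, Matrix.trace_sub, Complex.sub_re, hlin, hlin]
  have h1 := mul_le_mul_of_nonneg_left (hq1 f) (sub_nonneg.2 hu.2.le)
  have h2 := mul_le_mul_of_nonneg_left (hq2 f) hu.1.le
  simp only [Finset.sum_sub_distrib, ← Finset.mul_sum]
  linarith

/-- Monotonicity of the Holevo quantity under a channel between direct sums of matrix algebras. -/
theorem holevo_data_processing {L : G → F → κ → Matrix B A ℂ}
    (hL : ∀ f, ∑ g, ∑ k, (L g f k)ᴴ * L g f k = 1)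
    {ρ : τ → F → Matrix A A ℂ} (hρ : ∀ t f, (ρ t f).PosSemidef) :
    ∑ g, (natEntropy (∑ t, ∑ f, ∑ k, L g f k * ρ t f * (L g f k)ᴴ) -
      ∑ t, natEntropy (∑ f, ∑ k, L g f k * ρ t f * (L g f k)ᴴ)) ≤
    ∑ f, (natEntropy (∑ t, ρ t f) - ∑ t, natEntropy (ρ t f)) := by
  have hρB : ∀ g t, (∑ f, ∑ k, L g f k * ρ t f * (L g f k)ᴴ).PosSemidef := fun g t =>
    Matrix.posSemidef_sum _ fun f _ => Matrix.posSemidef_sum _ fun k _ =>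
      (hρ t f).mul_mul_conjTranspose_same _
  choose b hb hbi hbe using fun g => exists_integral_relFunctional (hρB g)
  choose a ha hai hae using fun f => exists_integral_relFunctional fun t => hρ t f
  have hsum : ∀ g, ∑ t, ∑ f, ∑ k, L g f k * ρ t f * (L g f k)ᴴ =
      ∑ f, ∑ k, L g f k * (∑ t, ρ t f) * (L g f k)ᴴ := fun g => by
    simp only [Matrix.mul_sum, Matrix.sum_mul]
    rw [Finset.sum_comm]
    exact Finset.sum_congr rfl fun f _ => Finset.sum_comm
  have htr : ∀ ω : F → Matrix A A ℂ, ∑ g, (∑ f, ∑ k, L g f k * ω f * (L g f k)ᴴ).trace.re =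
      ∑ f, (ω f).trace.re := by
    intro ω
    simp only [Matrix.trace_sum, Complex.re_sum]
    rw [Finset.sum_comm]
    refine Finset.sum_congr rfl fun f _ => ?_
    have : (ω f).trace = ∑ g, ∑ k, (L g f k * ω f * (L g f k)ᴴ).trace := by
      simp only [Matrix.trace_mul_comm _ (L _ _ _)ᴴ, ← Matrix.mul_assoc, ← Matrix.trace_sum,
        ← Finset.sum_mul, hL, Matrix.one_mul]
    simp only [this, Complex.re_sum]
  have hσ : ∀ f, (∑ t, ρ t f).PosSemidef := fun f => Matrix.posSemidef_sum _ fun t _ => hρ t f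
  have key : ∀ u ∈ Set.Ioo (0 : ℝ) 1, ∀ t, ∑ g, b g t u ≤ ∑ f, a f t u := by
    intro u hu t
    choose Y hY using fun g => (hb g u hu t).1
    calc ∑ g, b g t u = _ := Finset.sum_congr rfl fun g _ => (hY g).symm
      _ ≤ _ := by
        simp only [hsum]
        exact sum_relFunctional_le hL hu (hρ t) hσ Y
      _ ≤ _ := Finset.sum_le_sum fun f _ => (ha f u hu t).2 ⟨_, rfl⟩
  simp only [hbe, hae, Finset.sum_add_distrib]
  refine add_le_add (le_of_eq ?_) ?_
  · rw [Finset.sum_comm, Finset.sum_comm (s := (Finset.univ : Finset F))]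
    refine Finset.sum_congr rfl fun t _ => ?_
    simp only [Finset.sum_sub_distrib]
    rw [htr]
    simp only [hsum, htr]
  · rw [Finset.sum_comm, Finset.sum_comm (s := (Finset.univ : Finset F))]
    refine Finset.sum_le_sum fun t _ => ?_
    rw [← intervalIntegral.integral_finsetSum fun g _ => hbi g t,
      ← intervalIntegral.integral_finsetSum fun f _ => hai f t]
    refine intervalIntegral.integral_mono_on_of_le_Ioo zero_le_one ?_ ?_ fun u hu => ?_
    · simpa only [Finset.sum_fn] using IntervalIntegrable.sum Finset.univ fun g _ => hbi g t
    · simpa only [Finset.sum_fn] using IntervalIntegrable.sum Finset.univ fun f _ => hai f t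
    · rw [← Finset.mul_sum, ← Finset.mul_sum]
      exact mul_le_mul_of_nonneg_left (key u hu t) hu.1.le

end DataProcessing

section KrausFamily

variable {τ X : Type} [Fintype τ] [Fintype X]

theorem KrausFamily.apply_sum (N : KrausFamily A B) (ρ : τ → Matrix A A ℂ) :
    N.apply (∑ t, ρ t) = ∑ t, N.apply (ρ t) := by
  simp only [KrausFamily.apply, Matrix.mul_sum, Matrix.sum_mul]
  exact Finset.sum_comm

theorem KrausFamily.compl_sum (N : KrausFamily A B) (ρ : τ → Matrix A A ℂ) :
    N.compl (∑ t, ρ t) = ∑ t, N.compl (ρ t) := by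
  ext i j
  simp [KrausFamily.compl, Matrix.mul_sum, Matrix.sum_mul, Matrix.trace_sum, Matrix.sum_apply]

theorem KrausFamily.compl_eq_sum (N : KrausFamily A B) (ρ : Matrix A A ℂ) :
    N.compl ρ = ∑ b, (Matrix.of fun e a => N.K e b a) * ρ * (Matrix.of fun e a => N.K e b a)ᴴ := by
  ext i j
  rw [Matrix.sum_apply]
  rfl

theorem KrausFamily.posSemidef_apply (N : KrausFamily A B) {ρ : Matrix A A ℂ}
    (hρ : ρ.PosSemidef) : (N.apply ρ).PosSemidef :=
  Matrix.posSemidef_sum _ fun _ _ => hρ.mul_mul_conjTranspose_same _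

theorem KrausFamily.posSemidef_compl (N : KrausFamily A B) {ρ : Matrix A A ℂ}
    (hρ : ρ.PosSemidef) : (N.compl ρ).PosSemidef := by
  rw [N.compl_eq_sum]
  exact Matrix.posSemidef_sum _ fun _ _ => hρ.mul_mul_conjTranspose_same _

theorem mul_vecMulVec_star_mul (K : Matrix B A ℂ) (v : A → ℂ) :
    K * Matrix.vecMulVec v (star v) * Kᴴ = Matrix.vecMulVec (K *ᵥ v) (star (K *ᵥ v)) := by
  rw [Matrix.mul_vecMulVec, Matrix.vecMulVec_mul, Matrix.star_mulVec]

/-- On a pure input the output and the complementary output have the same entropy. -/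
theorem KrausFamily.natEntropy_apply_pure (N : KrausFamily A B) (v : A → ℂ) :
    natEntropy (N.apply (Matrix.vecMulVec v (star v))) =
      natEntropy (N.compl (Matrix.vecMulVec v (star v))) := by
  set M : Matrix B N.ι ℂ := Matrix.of fun b e => (N.K e *ᵥ v) b with hM
  have h1 : N.apply (Matrix.vecMulVec v (star v)) = M * Mᴴ := by
    simp only [KrausFamily.apply, mul_vecMulVec_star_mul]
    ext b b'
    simp [hM, Matrix.sum_apply, Matrix.mul_apply, Matrix.vecMulVec_apply]
  have h2 : N.compl (Matrix.vecMulVec v (star v)) = (Mᴴ * M)ᵀ := by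
    ext i j
    simp only [KrausFamily.compl, Matrix.of_apply, Matrix.mul_vecMulVec, Matrix.vecMulVec_mul,
      ← Matrix.star_mulVec, Matrix.trace_vecMulVec, Matrix.transpose_apply, Matrix.mul_apply, hM,
      Matrix.conjTranspose_apply, dotProduct, Pi.star_apply]
    exact Finset.sum_congr rfl fun b _ => mul_comm _ _
  rw [h1, h2, natEntropy_transpose, natEntropy_mul_comm]

/-- Coherent information in nats. -/
noncomputable def KrausFamily.natCohInfo (N : KrausFamily A B) (ρ : Matrix A A ℂ) : ℝ :=
  natEntropy (N.apply ρ) - natEntropy (N.compl ρ)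

/-- The coherent information of a degradable channel is superadditive on positive operators. -/
theorem KrausFamily.IsDegradable.sum_natCohInfo_le {N : KrausFamily A B} (hN : N.IsDegradable)
    {ρ : τ → Matrix A A ℂ} (hρ : ∀ t, (ρ t).PosSemidef) :
    ∑ t, N.natCohInfo (ρ t) ≤ N.natCohInfo (∑ t, ρ t) := by
  obtain ⟨D, hD, hcompl⟩ := hN
  have h := holevo_data_processing (F := Unit) (G := Unit) (L := fun _ _ => D.K)
    (by simpa [KrausFamily.IsChannel] using hD) (ρ := fun t _ => N.apply (ρ t))
    fun t _ => N.posSemidef_apply (hρ t)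
  have e : ∀ t, ∑ k, D.K k * N.apply (ρ t) * (D.K k)ᴴ = N.compl (ρ t) := fun t => hcompl (ρ t)
  simp only [Finset.univ_unique, Finset.sum_singleton, e, ← N.compl_sum, ← N.apply_sum] at h
  simp only [KrausFamily.natCohInfo, Finset.sum_sub_distrib]
  linarith

theorem KrausFamily.IsDegradable.natCohInfo_nonneg {N : KrausFamily A B} (hN : N.IsDegradable)
    (v : X → A → ℂ) : 0 ≤ N.natCohInfo (∑ x, Matrix.vecMulVec (v x) (star (v x))) := by
  refine le_trans (le_of_eq ?_) (hN.sum_natCohInfo_le fun x =>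
    Matrix.posSemidef_vecMulVec_self_star _)
  simp [KrausFamily.natCohInfo, N.natEntropy_apply_pure]

theorem sum_smul_conj {ι : Type} [Fintype ι] (K : ι → Matrix B A ℂ) (c c' : ι → ℂ)
    (ρ : Matrix A A ℂ) :
    (∑ e, c e • K e) * ρ * (∑ e, c' e • K e)ᴴ =
      ∑ e, ∑ e', (c e * star (c' e')) • (K e * ρ * (K e')ᴴ) := by
  simp only [Matrix.conjTranspose_sum, Matrix.mul_sum, Matrix.sum_mul, Matrix.conjTranspose_smul,
    Matrix.smul_mul, Matrix.mul_smul]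
  rw [Finset.sum_comm]
  simp only [Finset.smul_sum, smul_smul, mul_comm]

/-- The private information of a channel that is a mixture of conjugates of a degradable channel,
the mixing label being recoverable from the environment, is bounded by a single coherent
information of the degradable channel. -/
theorem private_information_le_natCohInfo {A' J : Type} [Fintype A'] [DecidableEq A'] [Fintype J]
    {N : KrausFamily A B} {M : KrausFamily A' B} (hM : M.IsDegradable)
    {V : J → Matrix A' A ℂ} {U : J → Matrix B B ℂ} {L : J → Matrix M.ι N.ι ℂ}
    (hU : ∀ j, (U j)ᴴ * U j = 1) (hL : ∑ j, (L j)ᴴ * L j = 1)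
    (hLK : ∀ j g, ∑ e, L j g e • N.K e = U j * M.K g * V j)
    (v : τ → X → A → ℂ) {ρ : τ → Matrix A A ℂ}
    (hρ : ∀ t, ρ t = ∑ x, Matrix.vecMulVec (v t x) (star (v t x))) :
    (natEntropy (N.apply (∑ t, ρ t)) - ∑ t, natEntropy (N.apply (ρ t))) -
      (natEntropy (N.compl (∑ t, ρ t)) - ∑ t, natEntropy (N.compl (ρ t))) ≤
    M.natCohInfo (∑ j, V j * (∑ t, ρ t) * (V j)ᴴ) := by
  have hcompl : ∀ j ρ, L j * N.compl ρ * (L j)ᴴ = M.compl (V j * ρ * (V j)ᴴ) := fun j ρ => by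
    ext g g'
    have e1 : (L j * N.compl ρ * (L j)ᴴ) g g' =
        ((∑ e, L j g e • N.K e) * ρ * (∑ e, L j g' e • N.K e)ᴴ).trace := by
      rw [sum_smul_conj, Matrix.mul_apply, Matrix.trace_sum]
      simp only [Matrix.mul_apply, Matrix.trace_sum, Matrix.trace_smul, smul_eq_mul,
        Finset.sum_mul, Matrix.conjTranspose_apply, KrausFamily.compl, Matrix.of_apply]
      rw [Finset.sum_comm]
      exact Finset.sum_congr rfl fun _ _ => Finset.sum_congr rfl fun _ _ => by ring
    rw [e1, hLK, hLK, KrausFamily.compl, Matrix.of_apply]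
    simp only [Matrix.conjTranspose_mul, Matrix.mul_assoc]
    rw [Matrix.trace_mul_comm]
    simp only [Matrix.mul_assoc, hU, Matrix.mul_one]
  have happly : ∀ ρ, ∑ j, U j * M.apply (V j * ρ * (V j)ᴴ) * (U j)ᴴ = N.apply ρ := fun ρ => by
    have e1 : ∀ j, U j * M.apply (V j * ρ * (V j)ᴴ) * (U j)ᴴ =
        ∑ e, ∑ e', ((L j)ᴴ * L j) e' e • (N.K e * ρ * (N.K e')ᴴ) := fun j => by
      have e2 : U j * M.apply (V j * ρ * (V j)ᴴ) * (U j)ᴴ =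
          ∑ g, (∑ e, L j g e • N.K e) * ρ * (∑ e, L j g e • N.K e)ᴴ := by
        simp only [hLK, KrausFamily.apply, Matrix.mul_sum, Matrix.sum_mul,
          Matrix.conjTranspose_mul, Matrix.mul_assoc]
      simp only [e2, sum_smul_conj, Matrix.mul_apply, Matrix.conjTranspose_apply, Finset.sum_smul]
      rw [Finset.sum_comm]
      refine Finset.sum_congr rfl fun _ _ => ?_
      rw [Finset.sum_comm]
      simp only [mul_comm]
    simp only [e1]
    rw [Finset.sum_comm]
    simp only [Finset.sum_comm (s := (Finset.univ : Finset J)), ← Finset.sum_smul,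
      ← Matrix.sum_apply, hL]
    simp [Matrix.one_apply, KrausFamily.apply]
  have hpos : ∀ t, (ρ t).PosSemidef := fun t => by
    rw [hρ]
    exact Matrix.posSemidef_sum _ fun x _ => Matrix.posSemidef_vecMulVec_self_star _
  have hposV : ∀ t j, (V j * ρ t * (V j)ᴴ).PosSemidef := fun t j =>
    (hpos t).mul_mul_conjTranspose_same _
  have hsumV : ∀ j, ∑ t, V j * ρ t * (V j)ᴴ = V j * (∑ t, ρ t) * (V j)ᴴ := fun j => by
    rw [Matrix.mul_sum, Matrix.sum_mul]
  have h1 := holevo_data_processing (G := Unit) (κ := Unit) (L := fun _ j _ => U j)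
    (by simpa using hU) (ρ := fun t j => M.apply (V j * ρ t * (V j)ᴴ))
    fun t j => M.posSemidef_apply (hposV t j)
  have h2 := holevo_data_processing (F := Unit) (κ := Unit) (L := fun j _ _ => L j)
    (by simpa using hL) (ρ := fun t _ => N.compl (ρ t))
    fun t _ => N.posSemidef_compl (hpos t)
  simp only [Finset.univ_unique, Finset.sum_singleton, happly, hcompl, ← N.apply_sum,
    ← N.compl_sum, ← M.apply_sum, ← M.compl_sum, hsumV] at h1 h2
  have h3 : ∀ t j, 0 ≤ M.natCohInfo (V j * ρ t * (V j)ᴴ) := fun t j => by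
    rw [hρ, Matrix.mul_sum, Matrix.sum_mul]
    simp only [mul_vecMulVec_star_mul]
    exact hM.natCohInfo_nonneg _
  have h4 : 0 ≤ ∑ j, ∑ t, M.natCohInfo (V j * ρ t * (V j)ᴴ) :=
    Finset.sum_nonneg fun j _ => Finset.sum_nonneg fun t _ => h3 t j
  have h5 := hM.sum_natCohInfo_le (ρ := fun j => V j * (∑ t, ρ t) * (V j)ᴴ) fun j => by
    rw [← hsumV j]; exact Matrix.posSemidef_sum _ fun t _ => hposV t j
  simp only [KrausFamily.natCohInfo, Finset.sum_sub_distrib] at h1 h2 h4 h5 ⊢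
  linarith

/-- The private information of an ensemble, as a difference of Holevo quantities of subnormalized
output states. -/
theorem privState_information_eq (N : KrausFamily A B) {nX nT : ℕ} {p : Fin nX → ℝ}
    (φ : Fin nX → A → ℂ) {pt : Fin nT → Fin nX → ℝ} (hp : ∀ x, 0 ≤ p x)
    (hpt : ∀ t x, 0 ≤ pt t x) {ρ : Fin nT → Matrix A A ℂ} {v : Fin nT → Fin nX → A → ℂ}
    (hv : v = fun t x => ((Real.sqrt (pt t x * p x) : ℝ) : ℂ) • φ x)
    (hρ : ∀ t, ρ t = ∑ x, Matrix.vecMulVec (v t x) (star (v t x))) :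
    (vnEntropy (red1 (privState N p φ pt)) + vnEntropy (red2 (privState N p φ pt))
          - vnEntropy (red12 (privState N p φ pt)))
      - (vnEntropy (red1 (privState N p φ pt)) + vnEntropy (red3 (privState N p φ pt))
          - vnEntropy (red13 (privState N p φ pt))) =
    ((natEntropy (N.apply (∑ t, ρ t)) - ∑ t, natEntropy (N.apply (ρ t))) -
      (natEntropy (N.compl (∑ t, ρ t)) - ∑ t, natEntropy (N.compl (ρ t)))) / Real.log 2 := by
  have hpos : ∀ t, (ρ t).PosSemidef := fun t => by
    rw [hρ]
    exact Matrix.posSemidef_sum _ fun x _ => Matrix.posSemidef_vecMulVec_self_star _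
  have hsq : ∀ t x, ((Real.sqrt (pt t x * p x) : ℝ) : ℂ) * ((Real.sqrt (pt t x * p x) : ℝ) : ℂ) =
      ((pt t x * p x : ℝ) : ℂ) := fun t x => by
    rw [← Complex.ofReal_mul, Real.mul_self_sqrt (mul_nonneg (hpt t x) (hp x))]
  have happ : ∀ t b b', N.apply (ρ t) b b' = ∑ e, ∑ x, ((pt t x * p x : ℝ) : ℂ) *
      ((N.K e *ᵥ φ x) b * star ((N.K e *ᵥ φ x) b')) := by
    intro t b b'
    rw [hρ, KrausFamily.apply, Matrix.sum_apply]
    refine Finset.sum_congr rfl fun e _ => ?_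
    rw [Matrix.mul_sum, Matrix.sum_mul, Matrix.sum_apply]
    refine Finset.sum_congr rfl fun x _ => ?_
    rw [mul_vecMulVec_star_mul, ← hsq, hv]
    simp [Matrix.mulVec_smul, Matrix.vecMulVec_apply]
    ring
  have hcom : ∀ t e e', N.compl (ρ t) e e' = ∑ b, ∑ x, ((pt t x * p x : ℝ) : ℂ) *
      ((N.K e *ᵥ φ x) b * star ((N.K e' *ᵥ φ x) b)) := by
    intro t e e'
    rw [hρ, KrausFamily.compl, Matrix.of_apply, Matrix.mul_sum, Matrix.sum_mul, Matrix.trace_sum,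
      Finset.sum_comm]
    refine Finset.sum_congr rfl fun x _ => ?_
    rw [Matrix.mul_vecMulVec, Matrix.vecMulVec_mul, ← Matrix.star_mulVec, Matrix.trace_vecMulVec,
      dotProduct]
    refine Finset.sum_congr rfl fun b _ => ?_
    rw [← hsq, hv]
    simp [Matrix.mulVec_smul]
    ring
  have e12 : red12 (privState N p φ pt) = Matrix.of fun z w : Fin nT × B =>
      if z.1 = w.1 then N.apply (ρ z.1) z.2 w.2 else 0 := by
    ext ⟨t, b⟩ ⟨t', b'⟩
    by_cases h : t = t' <;> simp [red12, privState, happ, h]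
  have e13 : red13 (privState N p φ pt) = Matrix.of fun z w : Fin nT × N.ι =>
      if z.1 = w.1 then N.compl (ρ z.1) z.2 w.2 else 0 := by
    ext ⟨t, b⟩ ⟨t', b'⟩
    by_cases h : t = t' <;> simp [red13, privState, hcom, h]
  have e2 : red2 (privState N p φ pt) = N.apply (∑ t, ρ t) := by
    ext b b'
    simp [red2, privState, N.apply_sum, Matrix.sum_apply, happ]
  have e3 : red3 (privState N p φ pt) = N.compl (∑ t, ρ t) := by
    ext b b'
    simp [red3, privState, N.compl_sum, Matrix.sum_apply, hcom]
  have hblock : ∀ {n : Type} [Fintype n] [DecidableEq n] (σ : Fin nT → Matrix n n ℂ),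
      (∀ t, (σ t).IsHermitian) → (Matrix.of fun z w : Fin nT × n =>
        if z.1 = w.1 then σ z.1 z.2 w.2 else 0).IsHermitian := by
    intro n _ _ σ hσ
    ext ⟨t, i⟩ ⟨t', i'⟩
    rcases eq_or_ne t t' with rfl | h
    · simpa using congrFun (congrFun (hσ t) i) i'
    · simp [h, h.symm]
  have hposσ : (∑ t, ρ t).PosSemidef := Matrix.posSemidef_sum _ fun t _ => hpos t
  have hb1 := natEntropy_block fun t => N.apply (ρ t)
  have hb2 := natEntropy_block fun t => N.compl (ρ t)
  rw [e12, e13, e2, e3,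
    vnEntropy_eq_natEntropy_div (hblock _ fun t => (N.posSemidef_apply (hpos t)).isHermitian),
    vnEntropy_eq_natEntropy_div (hblock _ fun t => (N.posSemidef_compl (hpos t)).isHermitian),
    vnEntropy_eq_natEntropy_div (N.posSemidef_apply hposσ).isHermitian,
    vnEntropy_eq_natEntropy_div (N.posSemidef_compl hposσ).isHermitian,
    hb1, hb2]
  ring

end KrausFamily

section TensorPower

variable {C ι κ : Type} [Fintype ι] [Fintype κ] {n : ℕ}

/-- The Kronecker product of a finite list of matrices of the same shape. -/
def tensorPow (M : Fin n → Matrix B A ℂ) : Matrix (Fin n → B) (Fin n → A) ℂ :=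
  Matrix.of fun b a => ∏ i, M i (b i) (a i)

theorem tensorPow_mul (M : Fin n → Matrix C B ℂ) (M' : Fin n → Matrix B A ℂ) :
    tensorPow M * tensorPow M' = tensorPow fun i => M i * M' i := by
  ext c a
  simp only [tensorPow, Matrix.mul_apply, Matrix.of_apply, ← Finset.prod_mul_distrib]
  rw [Finset.prod_univ_sum, Fintype.piFinset_univ]

theorem conjTranspose_tensorPow (M : Fin n → Matrix B A ℂ) :
    (tensorPow M)ᴴ = tensorPow fun i => (M i)ᴴ := by
  ext a b
  simp [tensorPow]

theorem sum_tensorPow (M : Fin n → ι → Matrix B A ℂ) :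
    ∑ f : Fin n → ι, tensorPow (fun i => M i (f i)) = tensorPow fun i => ∑ k, M i k := by
  ext b a
  simp only [tensorPow, Matrix.sum_apply, Matrix.of_apply]
  rw [Finset.prod_univ_sum, Fintype.piFinset_univ]

theorem tensorPow_diagonal (d : Fin n → A → ℂ) :
    tensorPow (fun i => Matrix.diagonal (d i)) =
      Matrix.diagonal fun a : Fin n → A => ∏ i, d i (a i) := by
  ext a a'
  rcases eq_or_ne a a' with rfl | h
  · simp [tensorPow]
  · obtain ⟨i, hi⟩ := Function.ne_iff.1 h
    simp only [tensorPow, Matrix.of_apply, Matrix.diagonal_apply_ne _ h]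
    exact Finset.prod_eq_zero (Finset.mem_univ i) (Matrix.diagonal_apply_ne _ hi)

theorem tensorPow_one : tensorPow (fun _ : Fin n => (1 : Matrix A A ℂ)) = 1 := by
  simp only [← Matrix.diagonal_one, tensorPow_diagonal, Finset.prod_const_one]

theorem sum_tensorPow_smul (M : Fin n → Matrix C κ ℂ) (K : κ → Matrix B A ℂ) (c : Fin n → C) :
    ∑ f : Fin n → κ, tensorPow M c f • tensorPow (fun i => K (f i)) =
      tensorPow fun i => ∑ k, M i (c i) k • K k := by
  rw [← sum_tensorPow]
  refine Finset.sum_congr rfl fun f _ => ?_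
  ext b a
  simp [tensorPow, Finset.prod_mul_distrib]

/-- The entries of a tensor power of a completely positive map, in terms of its Choi matrix. -/
theorem sum_tensorPow_conj_apply (K : ι → Matrix B A ℂ)
    (ρ : Matrix (Fin n → A) (Fin n → A) ℂ) (b b' : Fin n → B) :
    (∑ f : Fin n → ι, tensorPow (fun i => K (f i)) * ρ * (tensorPow fun i => K (f i))ᴴ) b b' =
      ∑ a, ∑ a', (∏ i, ∑ k, K k (b i) (a i) * star (K k (b' i) (a' i))) * ρ a a' := by
  simp only [Finset.prod_univ_sum, Fintype.piFinset_univ, Finset.prod_mul_distrib, Finset.sum_mul,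
    Matrix.sum_apply, Matrix.mul_apply, tensorPow, Matrix.of_apply, Matrix.conjTranspose_apply,
    star_prod]
  conv_lhs => rw [Finset.sum_comm]
  conv_rhs => rw [Finset.sum_comm]
  refine Finset.sum_congr rfl fun _ _ => ?_
  rw [Finset.sum_comm]
  refine Finset.sum_congr rfl fun _ _ => Finset.sum_congr rfl fun _ _ => ?_
  ring

/-- Tensor powers of completely positive maps with the same Choi matrix are equal. -/
theorem sum_tensorPow_conj_congr {K : ι → Matrix B A ℂ} {K' : κ → Matrix B A ℂ}
    (h : ∀ b b' a a', ∑ k, K k b a * star (K k b' a') = ∑ k, K' k b a * star (K' k b' a'))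
    (ρ : Matrix (Fin n → A) (Fin n → A) ℂ) :
    ∑ f : Fin n → ι, tensorPow (fun i => K (f i)) * ρ * (tensorPow fun i => K (f i))ᴴ =
      ∑ f : Fin n → κ, tensorPow (fun i => K' (f i)) * ρ * (tensorPow fun i => K' (f i))ᴴ := by
  ext b b'
  simp only [sum_tensorPow_conj_apply, h]

theorem KrausFamily.IsChannel.pow {N : KrausFamily A B} (hN : N.IsChannel) (n : ℕ) :
    (N.pow n).IsChannel := by
  change ∑ f : Fin n → N.ι, (tensorPow fun i => N.K (f i))ᴴ * (tensorPow fun i => N.K (f i)) = 1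
  simp only [conjTranspose_tensorPow, tensorPow_mul]
  rw [sum_tensorPow fun _ k => (N.K k)ᴴ * N.K k]
  simp only [show ∑ k, (N.K k)ᴴ * N.K k = 1 from hN, tensorPow_one]

/-- Tensor powers of a degradable channel are degradable, with degradability being checked on Choi
matrices. -/
theorem KrausFamily.isDegradable_pow {N : KrausFamily A B} {D : KrausFamily B N.ι}
    (hD : D.IsChannel)
    (h : ∀ e e' a a', ∑ k : D.ι × N.ι, (D.K k.1 * N.K k.2) e a * star ((D.K k.1 * N.K k.2) e' a') =
      ∑ b, N.K e b a * star (N.K e' b a')) (n : ℕ) : (N.pow n).IsDegradable := by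
  refine ⟨D.pow n, hD.pow n, fun ρ => ?_⟩
  have h1 := sum_tensorPow_conj_congr (K := fun k : D.ι × N.ι => D.K k.1 * N.K k.2)
    (K' := fun b => Matrix.of fun e a => N.K e b a) h ρ
  rw [KrausFamily.compl_eq_sum]
  refine Eq.trans ?_ h1
  rw [← (Equiv.arrowProdEquivProdArrow (Fin n) (fun _ => D.ι) (fun _ => N.ι)).symm.sum_comp,
    Fintype.sum_prod_type]
  simp only [← tensorPow_mul, Matrix.conjTranspose_mul]
  simp only [KrausFamily.apply, Matrix.mul_sum, Matrix.sum_mul, Matrix.mul_assoc]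
  rfl

theorem sum_negMulLog_prod (d : A → ℝ) (hd : ∑ a, d a = 1) (n : ℕ) :
    ∑ f : Fin n → A, Real.negMulLog (∏ i, d (f i)) = n * ∑ a, Real.negMulLog (d a) := by
  induction n with
  | zero => simp
  | succ n ih =>
    have hn : ∑ f : Fin n → A, ∏ i, d (f i) = 1 := by
      have := Finset.prod_univ_sum (fun _ : Fin n => (Finset.univ : Finset A)) fun _ a => d a
      rw [Fintype.piFinset_univ] at this
      rw [← this]; simp [hd]
    rw [← (Fin.consEquiv fun _ : Fin (n + 1) => A).sum_comp, Fintype.sum_prod_type]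
    simp only [Fin.consEquiv_apply, Fin.prod_univ_succ, Fin.cons_zero, Fin.cons_succ,
      Real.negMulLog_mul, Finset.sum_add_distrib, ← Finset.mul_sum, ← Finset.sum_mul, hn, hd, ih]
    push_cast
    ring

end TensorPower

section AmplitudeDamping

/-- The Kraus operators of the amplitude damping channel, with `r` and `s` the cosine and sine of
the damping angle. -/
noncomputable def ampDampKraus (r s : ℝ) : Fin 2 → Matrix (Fin 2) (Fin 2) ℂ :=
  ![!![1, 0; 0, (r : ℂ)], !![0, (s : ℂ); 0, 0]]

theorem ampDampKraus_zero (r s : ℝ) : ampDampKraus r s 0 = !![1, 0; 0, (r : ℂ)] := rfl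

theorem ampDampKraus_one (r s : ℝ) : ampDampKraus r s 1 = !![0, (s : ℂ); 0, 0] := rfl

/-- The amplitude damping channel. -/
noncomputable def ampDamp (r s : ℝ) : KrausFamily (Fin 2) (Fin 2) where
  ι := Fin 2
  K := ampDampKraus r s

theorem ampDamp_isChannel {r s : ℝ} (h : r ^ 2 + s ^ 2 = 1) : (ampDamp r s).IsChannel := by
  have h' : (s : ℂ) * s + r * r = 1 := by rw [← Complex.ofReal_one, ← h]; push_cast; ring
  change ∑ i : Fin 2, (ampDampKraus r s i)ᴴ * ampDampKraus r s i = 1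
  rw [Fin.sum_univ_two, ampDampKraus_zero, ampDampKraus_one]
  ext a b
  fin_cases a <;> fin_cases b <;>
    simp [Matrix.mul_apply, add_comm _ ((s : ℂ) * s), h']

theorem ampDamp_pow_isDegradable {r s : ℝ} (h : r ^ 2 + s ^ 2 = 1) (hs : s ^ 2 ≤ 1 / 2) (n : ℕ) :
    ((ampDamp r s).pow n).IsDegradable := by
  have hr : 0 < r ^ 2 := by linarith
  have hr0 : (r : ℂ) ≠ 0 := by
    rintro h0
    norm_num [Complex.ofReal_eq_zero.1 h0] at hr
  have hle : 0 ≤ 1 - (s / r) ^ 2 := by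
    rw [div_pow, sub_nonneg, div_le_one hr]
    linarith
  have hsq := Real.sq_sqrt hle
  set s' := Real.sqrt (1 - (s / r) ^ 2)
  have h1 : (s / r) ^ 2 + s' ^ 2 = 1 := by rw [hsq]; ring
  have h2 : (s : ℂ) * s + s' * r * (s' * r) = r * r := by
    have : s * s + s' * r * (s' * r) = r * r := by
      have hr' : r ≠ 0 := by exact_mod_cast hr0
      field_simp at h1
      linarith
    exact_mod_cast this
  refine KrausFamily.isDegradable_pow (N := ampDamp r s) (D := ampDamp (s / r) s')
    (ampDamp_isChannel h1) ?_ n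
  change ∀ e e' a a' : Fin 2, ∑ k : Fin 2 × Fin 2,
    (ampDampKraus (s / r) s' k.1 * ampDampKraus r s k.2) e a *
      star ((ampDampKraus (s / r) s' k.1 * ampDampKraus r s k.2) e' a') =
    ∑ b : Fin 2, ampDampKraus r s e b a * star (ampDampKraus r s e' b a')
  intro e e' a a'
  simp only [Fintype.sum_prod_type, Fin.sum_univ_two, ampDampKraus_zero, ampDampKraus_one]
  fin_cases e <;> fin_cases e' <;> fin_cases a <;> fin_cases a' <;>
    simp [Matrix.mul_apply, hr0, h2, ampDampKraus_zero, ampDampKraus_one]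

/-- The entropy of a product state obtained from the maximally mixed state. -/
theorem natEntropy_sum_tensorPow_half {ι : Type} [Fintype ι] {K : ι → Matrix B A ℂ} {d : B → ℝ}
    (hd : ∑ b, d b = 1)
    (hK : ∑ k, K k * ((1 / 2 : ℂ) • (1 : Matrix A A ℂ)) * (K k)ᴴ =
      Matrix.diagonal fun b => (d b : ℂ)) {n : ℕ} {ρ : Matrix (Fin n → A) (Fin n → A) ℂ}
    (hρ : ρ = tensorPow fun _ => (1 / 2 : ℂ) • 1) :
    natEntropy (∑ f : Fin n → ι,
      tensorPow (fun i => K (f i)) * ρ * (tensorPow fun i => K (f i))ᴴ) =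
      n * ∑ b, Real.negMulLog (d b) := by
  have h : ∑ f : Fin n → ι, tensorPow (fun i => K (f i)) * ρ * (tensorPow fun i => K (f i))ᴴ =
      Matrix.diagonal fun f : Fin n → B => ((∏ i, d (f i) : ℝ) : ℂ) := by
    have := sum_tensorPow fun (_ : Fin n) k => K k * ((1 / 2 : ℂ) • (1 : Matrix A A ℂ)) * (K k)ᴴ
    simp only [hK, tensorPow_diagonal, ← Complex.ofReal_prod] at this
    rw [← this]
    refine Finset.sum_congr rfl fun f _ => ?_
    rw [hρ, conjTranspose_tensorPow, tensorPow_mul, tensorPow_mul]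
  rw [h, natEntropy_diagonal, sum_negMulLog_prod d hd]

theorem ampDamp_pow_natCohInfo {r s a : ℝ} (hr : r ^ 2 = 1 - 2 * a) (hs : s ^ 2 = 2 * a) (n : ℕ) :
    ((ampDamp r s).pow n).natCohInfo (tensorPow fun _ => (1 / 2 : ℂ) • 1) =
      n * (Real.binEntropy (1 / 2 - a) - Real.binEntropy a) := by
  have hr' : (r : ℂ) ^ 2 = 1 - 2 * a := by exact_mod_cast hr
  have hs' : (s : ℂ) ^ 2 = 2 * a := by exact_mod_cast hs
  have h1 := natEntropy_sum_tensorPow_half (K := ampDampKraus r s) (d := ![1 / 2 + a, 1 / 2 - a])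
    (by simp; norm_num) (by
      rw [Fin.sum_univ_two, ampDampKraus_zero, ampDampKraus_one]
      simp only [Matrix.mul_smul, Matrix.mul_one, Matrix.smul_mul]
      ext i j
      simp only [Matrix.add_apply, Matrix.smul_apply, Matrix.mul_apply, Fin.sum_univ_two,
        Matrix.conjTranspose_apply]
      fin_cases i <;> fin_cases j <;> simp
      · linear_combination (1 / 2 : ℂ) * hs'
      · linear_combination (1 / 2 : ℂ) * hr')
    (n := n) rfl
  have h2 := natEntropy_sum_tensorPow_half
    (K := fun b : Fin 2 => Matrix.of fun e a : Fin 2 => ampDampKraus r s e b a)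
    (d := ![1 - a, a]) (by simp) (by
      rw [Fin.sum_univ_two]
      simp only [Matrix.mul_smul, Matrix.mul_one, Matrix.smul_mul]
      ext i j
      fin_cases i <;> fin_cases j <;>
        simp [ampDampKraus_zero, ampDampKraus_one, Matrix.mul_apply]
      · linear_combination (1 / 2 : ℂ) * hr'
      · linear_combination (1 / 2 : ℂ) * hs') (n := n) rfl
  have e1 : natEntropy (((ampDamp r s).pow n).apply (tensorPow fun _ => (1 / 2 : ℂ) • 1)) = _ := h1
  have e2 : natEntropy (((ampDamp r s).pow n).compl (tensorPow fun _ => (1 / 2 : ℂ) • 1)) = _ :=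
    (congrArg natEntropy (KrausFamily.compl_eq_sum _ _)).trans h2
  rw [KrausFamily.natCohInfo, e1, e2, Real.binEntropy_eq_negMulLog_add_negMulLog_one_sub,
    Real.binEntropy_eq_negMulLog_add_negMulLog_one_sub]
  simp only [Fin.sum_univ_two, Matrix.cons_val_zero, Matrix.cons_val_one]
  rw [show 1 - (1 / 2 - a) = 1 / 2 + a by ring]
  ring

end AmplitudeDamping

section BB84

/-- The Pauli matrices, rotated to the eigenbasis of `Y` and scaled by `√2`. -/
noncomputable def rotatedPauli : Fin 4 → Matrix (Fin 2) (Fin 2) ℂ :=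
  ![!![1, -Complex.I; 1, Complex.I], !![-Complex.I, 1; Complex.I, 1],
    !![1, Complex.I; 1, -Complex.I], !![1, -Complex.I; -1, -Complex.I]]

theorem rotatedPauli_zero : rotatedPauli 0 = !![1, -Complex.I; 1, Complex.I] := rfl

theorem rotatedPauli_one : rotatedPauli 1 = !![-Complex.I, 1; Complex.I, 1] := rfl

theorem rotatedPauli_two : rotatedPauli 2 = !![1, Complex.I; 1, -Complex.I] := rfl

theorem rotatedPauli_three : rotatedPauli 3 = !![1, -Complex.I; -1, -Complex.I] := rfl

/-- The operators by which the environment of the BB84 channel recovers the label of a Pauli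
conjugate of the amplitude damping channel, and the environment of the latter. -/
noncomputable def envInstrument : Fin 4 → Matrix (Fin 2) (Fin 4) ℂ :=
  ![!![1 / 2, 0, 0, 1 / 2; 0, Complex.I / 2, 1 / 2, 0],
    !![1 / 2, 0, 0, -1 / 2; 0, Complex.I / 2, -1 / 2, 0],
    !![1 / 2, 0, 0, -1 / 2; 0, -Complex.I / 2, 1 / 2, 0],
    !![1 / 2, 0, 0, 1 / 2; 0, -Complex.I / 2, -1 / 2, 0]]

theorem envInstrument_zero :
    envInstrument 0 = !![1 / 2, 0, 0, 1 / 2; 0, Complex.I / 2, 1 / 2, 0] := rfl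

theorem envInstrument_one :
    envInstrument 1 = !![1 / 2, 0, 0, -1 / 2; 0, Complex.I / 2, -1 / 2, 0] := rfl

theorem envInstrument_two :
    envInstrument 2 = !![1 / 2, 0, 0, -1 / 2; 0, -Complex.I / 2, 1 / 2, 0] := rfl

theorem envInstrument_three :
    envInstrument 3 = !![1 / 2, 0, 0, 1 / 2; 0, -Complex.I / 2, -1 / 2, 0] := rfl

theorem rotatedPauli_mul_conjTranspose (j : Fin 4) :
    rotatedPauli j * (rotatedPauli j)ᴴ = (2 : ℂ) • 1 := by
  have hj : j = 0 ∨ j = 1 ∨ j = 2 ∨ j = 3 := by omega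
  ext a b
  simp only [Matrix.mul_apply, Fin.sum_univ_two, Matrix.conjTranspose_apply]
  rcases hj with rfl | rfl | rfl | rfl <;> fin_cases a <;> fin_cases b <;>
    norm_num [rotatedPauli_zero, rotatedPauli_one, rotatedPauli_two, rotatedPauli_three,
      Complex.ext_iff]

theorem sum_rotatedPauli (b b' a a' : Fin 2) :
    ∑ j, rotatedPauli j b a * star (rotatedPauli j b' a') =
      4 * ((1 : Matrix (Fin 2) (Fin 2) ℂ) b b' * (1 : Matrix (Fin 2) (Fin 2) ℂ) a a') := by
  rw [Fin.sum_univ_four, rotatedPauli_zero, rotatedPauli_one, rotatedPauli_two,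
    rotatedPauli_three]
  fin_cases b <;> fin_cases b' <;> fin_cases a <;> fin_cases a' <;>
    norm_num [Complex.ext_iff]

theorem sum_conjTranspose_mul_envInstrument :
    ∑ j, (envInstrument j)ᴴ * envInstrument j = 1 := by
  rw [Fin.sum_univ_four, envInstrument_zero, envInstrument_one, envInstrument_two,
    envInstrument_three]
  ext a b
  fin_cases a <;> fin_cases b <;>
    norm_num [Matrix.mul_apply, Complex.ext_iff, map_ofNat]

theorem sum_envInstrument_smul {q w : ℝ} (hw : w = Real.sqrt (q * (1 - q))) (j : Fin 4)
    (g : Fin 2) :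
    ∑ e, envInstrument j g e • (NBB84 q).K e =
      (1 / 4 : ℂ) • ((rotatedPauli j)ᴴ * ampDampKraus (1 - 2 * q) (2 * w) g * rotatedPauli j) := by
  have hK : (NBB84 q).K = (![((1 - q : ℝ) : ℂ) • 1, (w : ℂ) • PauliX, (w : ℂ) • PauliZ,
      (q : ℂ) • PauliY] : Fin 4 → Matrix (Fin 2) (Fin 2) ℂ) := by rw [hw]; rfl
  rw [hK]
  refine (Fin.sum_univ_four (fun e : Fin 4 => _)).trans ?_
  change envInstrument j g 0 • (((1 - q : ℝ) : ℂ) • (1 : Matrix (Fin 2) (Fin 2) ℂ)) +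
    envInstrument j g 1 • ((w : ℂ) • PauliX) + envInstrument j g 2 • ((w : ℂ) • PauliZ) +
    envInstrument j g 3 • ((q : ℂ) • PauliY) = _
  have hj : j = 0 ∨ j = 1 ∨ j = 2 ∨ j = 3 := by omega
  rcases hj with rfl | rfl | rfl | rfl <;>
  simp only [envInstrument_zero, envInstrument_one, envInstrument_two, envInstrument_three,
    rotatedPauli_zero, rotatedPauli_one, rotatedPauli_two, rotatedPauli_three] <;>
  ext a b <;>
  fin_cases g <;> fin_cases a <;> fin_cases b <;>
    simp [ampDampKraus_zero, ampDampKraus_one, Matrix.mul_apply, PauliX, PauliY, PauliZ] <;>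
    norm_num [Complex.ext_iff] <;>
    ring_nf

end BB84

section Bound

/-- Scaled rotated Pauli matrices twirl every operator to a multiple of the identity. -/
theorem sum_tensorPow_rotatedPauli {n : ℕ} {c : ℂ} (hc : c * star c = 1 / 8)
    (ρ : Matrix (Fin n → Fin 2) (Fin n → Fin 2) ℂ) :
    ∑ f : Fin n → Fin 4, tensorPow (fun i => c • rotatedPauli (f i)) * ρ *
      (tensorPow fun i => c • rotatedPauli (f i))ᴴ =
      ρ.trace • tensorPow fun _ => (1 / 2 : ℂ) • 1 := by
  ext b b'
  rw [sum_tensorPow_conj_apply fun j => c • rotatedPauli j]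
  have h : ∀ b b' a a' : Fin 2,
      ∑ j, (c • rotatedPauli j) b a * star ((c • rotatedPauli j) b' a') =
        ((1 / 2 : ℂ) • (1 : Matrix (Fin 2) (Fin 2) ℂ)) b b' *
          (1 : Matrix (Fin 2) (Fin 2) ℂ) a a' := fun b b' a a' => by
    have e : ∑ j, (c • rotatedPauli j) b a * star ((c • rotatedPauli j) b' a') =
        c * star c * ∑ j, rotatedPauli j b a * star (rotatedPauli j b' a') := by
      rw [Finset.mul_sum]
      refine Finset.sum_congr rfl fun j _ => ?_
      simp only [Matrix.smul_apply, smul_eq_mul, star_mul']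
      ring
    rw [e, sum_rotatedPauli, hc, Matrix.smul_apply, smul_eq_mul]
    ring
  have h1 : ∀ a a' : Fin n → Fin 2, ∏ i, (1 : Matrix (Fin 2) (Fin 2) ℂ) (a i) (a' i) =
      (1 : Matrix (Fin n → Fin 2) (Fin n → Fin 2) ℂ) a a' := fun a a' => by
    rw [← tensorPow_one]; rfl
  simp only [h, Finset.prod_mul_distrib, h1]
  rw [Matrix.smul_apply, smul_eq_mul, Matrix.trace, Finset.sum_mul]
  refine Finset.sum_congr rfl fun a _ => ?_
  rw [Finset.sum_eq_single a]
  · rw [Matrix.one_apply_eq, mul_one, mul_comm]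
    rfl
  · intro a' _ ha
    rw [Matrix.one_apply_ne ha.symm, mul_zero, zero_mul]
  · simp

theorem sum_conjTranspose_mul_tensorPow_envInstrument (n : ℕ) :
    ∑ f : Fin n → Fin 4, (tensorPow fun i => envInstrument (f i))ᴴ *
      (tensorPow fun i => envInstrument (f i)) = 1 := by
  simp only [conjTranspose_tensorPow, tensorPow_mul]
  refine (sum_tensorPow fun _ k => (envInstrument k)ᴴ * envInstrument k).trans ?_
  simp only [sum_conjTranspose_mul_envInstrument]
  exact tensorPow_one

theorem binEnt_eq_binEntropy_div (x : ℝ) : binEnt x = Real.binEntropy x / Real.log 2 := by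
  rw [binEnt, Real.binEntropy_eq_negMulLog_add_negMulLog_one_sub, Real.negMulLog, Real.negMulLog,
    Real.logb, Real.logb]
  ring

theorem binEnt_sub_nonneg {a : ℝ} (h0 : 0 ≤ a) (h1 : a ≤ 1 / 4) :
    0 ≤ binEnt (1 / 2 - a) - binEnt a := by
  rw [binEnt_eq_binEntropy_div, binEnt_eq_binEntropy_div, ← sub_div]
  refine div_nonneg (sub_nonneg.2 ?_) (Real.log_nonneg one_le_two)
  exact Real.binEntropy_strictMonoOn.monotoneOn ⟨h0, by linarith⟩
    ⟨by linarith, by linarith⟩ (by linarith)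

theorem Cp1_NBB84_pow_le (q : ℝ) (hq0 : 0 ≤ q) (hq1 : q ≤ 1) (hγ : 4 * q * (1 - q) ≤ 1 / 2)
    (n : ℕ) : Cp1 ((NBB84 q).pow n) ≤
      n * (binEnt (1 / 2 - 2 * q * (1 - q)) - binEnt (2 * q * (1 - q))) := by
  have hw0 : 0 ≤ q * (1 - q) := mul_nonneg hq0 (by linarith)
  refine Real.sSup_le ?_ (mul_nonneg n.cast_nonneg
    (binEnt_sub_nonneg (by linarith) (by linarith)))
  rintro x ⟨nX, nT, p, φ, pt, hp, hp1, hφ, hpt, hpt1, rfl⟩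
  obtain ⟨w, hw⟩ : ∃ w, w = Real.sqrt (q * (1 - q)) := ⟨_, rfl⟩
  have hw2 : w ^ 2 = q * (1 - q) := by rw [hw, Real.sq_sqrt hw0]
  obtain ⟨v, hv⟩ : ∃ v : Fin nT → Fin nX → (Fin n → Fin 2) → ℂ,
    v = fun t x => ((Real.sqrt (pt t x * p x) : ℝ) : ℂ) • φ x := ⟨_, rfl⟩
  obtain ⟨ρ, hρ⟩ : ∃ ρ : Fin nT → Matrix (Fin n → Fin 2) (Fin n → Fin 2) ℂ,
    ∀ t, ρ t = ∑ x, Matrix.vecMulVec (v t x) (star (v t x)) := ⟨_, fun _ => rfl⟩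
  obtain ⟨c, hc⟩ : ∃ c : ℂ, c = ((Real.sqrt 2 / 2 : ℝ) : ℂ) := ⟨_, rfl⟩
  have hcc : c * c = 1 / 2 := by
    rw [hc, ← Complex.ofReal_mul, show Real.sqrt 2 / 2 * (Real.sqrt 2 / 2) = 1 / 2 by
      rw [div_mul_div_comm, Real.mul_self_sqrt zero_le_two]; norm_num]
    norm_num
  have hcs : star c = c := by rw [hc]; exact Complex.conj_ofReal _
  have htr : (∑ t, ρ t).trace = 1 := by
    have h1 : ∀ t x, (Matrix.vecMulVec (v t x) (star (v t x))).trace = ((pt t x * p x : ℝ) : ℂ) :=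
      fun t x => by
        have h2 : φ x ⬝ᵥ star (φ x) = 1 := by
          have := congrArg Complex.ofReal (hφ x)
          simpa [dotProduct, Complex.mul_conj, Complex.normSq_eq_norm_sq] using this
        rw [Matrix.trace_vecMulVec, hv, star_smul, smul_dotProduct, dotProduct_smul, h2]
        simp only [smul_eq_mul, mul_one, Complex.star_def, Complex.conj_ofReal]
        rw [← Complex.ofReal_mul, Real.mul_self_sqrt (mul_nonneg (hpt t x) (hp x))]
    simp only [hρ, Matrix.trace_sum, h1]
    rw [Finset.sum_comm]
    have h3 : ∑ x, ∑ t, pt t x * p x = 1 := by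
      simp only [← Finset.sum_mul, hpt1, one_mul, hp1]
    exact_mod_cast h3
  have hs2 : (2 * w) ^ 2 ≤ 1 / 2 := by nlinarith
  have key := private_information_le_natCohInfo (N := (NBB84 q).pow n)
    (ampDamp_pow_isDegradable (r := 1 - 2 * q) (s := 2 * w) (by nlinarith) hs2 n)
    (V := fun f : Fin n → Fin 4 => tensorPow fun i => (c / 2) • rotatedPauli (f i))
    (U := fun f => tensorPow fun i => c • (rotatedPauli (f i))ᴴ)
    (L := fun f => tensorPow fun i => envInstrument (f i)) (fun f => by
      rw [conjTranspose_tensorPow, tensorPow_mul, ← tensorPow_one]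
      congr 1
      funext i
      rw [Matrix.conjTranspose_smul, Matrix.conjTranspose_conjTranspose, Matrix.smul_mul,
        Matrix.mul_smul, rotatedPauli_mul_conjTranspose, smul_smul, smul_smul, hcs, hcc]
      norm_num) (sum_conjTranspose_mul_tensorPow_envInstrument n) (fun f g => by
      refine (sum_tensorPow_smul (fun i => envInstrument (f i)) (NBB84 q).K g).trans ?_
      change _ = tensorPow (fun i => c • (rotatedPauli (f i))ᴴ) *
        tensorPow (fun i => ampDampKraus (1 - 2 * q) (2 * w) (g i)) *
        tensorPow (fun i => (c / 2) • rotatedPauli (f i))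
      rw [tensorPow_mul, tensorPow_mul]
      congr 1
      funext i
      rw [Matrix.smul_mul, Matrix.smul_mul, Matrix.mul_smul, smul_smul,
        show c * (c / 2) = 1 / 4 by linear_combination hcc / 2]
      exact sum_envInstrument_smul hw (f i) (g i)) v hρ
  rw [sum_tensorPow_rotatedPauli (by
      rw [star_div₀, hcs, star_ofNat]; linear_combination hcc / 4), htr, one_smul,
    ampDamp_pow_natCohInfo (a := 2 * q * (1 - q)) (by ring) (by nlinarith)] at key
  rw [privState_information_eq _ φ hp hpt hv hρ, binEnt_eq_binEntropy_div,
    binEnt_eq_binEntropy_div, ← sub_div, ← mul_div_assoc]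
  exact div_le_div_of_nonneg_right key (Real.log_nonneg one_le_two)

end Bound

/-- For `0 ≤ q ≤ 1` with `4q(1−q) ≤ 1/2`, the private classical
capacity of the BB84 channel satisfies
`C_p(N^BB84_q) ≤ H(1/2 − 2q(1−q)) − H(2q(1−q))`. -/
theorem Cp_NBB84_le (q : ℝ) (hq0 : 0 ≤ q) (hq1 : q ≤ 1)
    (hγ : 4 * q * (1 - q) ≤ 1 / 2) :
    Cp (NBB84 q) ≤ binEnt (1 / 2 - 2 * q * (1 - q)) - binEnt (2 * q * (1 - q)) := by
  refine Real.sSup_le ?_ (by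
    rw [mul_assoc]
    exact binEnt_sub_nonneg (by nlinarith) (by nlinarith))
  rintro x ⟨n, hn, rfl⟩
  rw [one_div, inv_mul_le_iff₀ (by exact_mod_cast hn)]
  exact Cp1_NBB84_pow_le q hq0 hq1 hγ n
end

section
/- For all reals u, v: the output of N_(u,v) on the maximally mixed state, N_(u,v)(I/2) = ½(A₊A₊† + A₋A₋†), is diagonal with eigenvalues ½(1 + sin u · sin v) and ½(1 − sin u · sin v), while the complementary output N̂_(u,v)(I/2), the 2×2 matrix with entries Tr(A_i (I/2) A_j†) for i,j ∈ {+,−}, is diagonal with eigenvalues ½(1 + cos u · cos v) and ½(1 − cos u · cos v). Consequently I^c(N_(u,v), I/2) = H(½(1 + sin u · sin v)) − H(½(1 + cos u · cos v)). -/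
open scoped Matrix Kronecker ComplexOrder

variable {A B : Type} [Fintype A] [DecidableEq A] [Fintype B] [DecidableEq B]

/-- The Kraus operator `A₊` of the channel `N_(u,v)`. -/
noncomputable def Aplus (u v : ℝ) : Matrix (Fin 2) (Fin 2) ℂ :=
  !![((Real.cos ((v - u) / 2) : ℝ) : ℂ), 0; 0, ((Real.cos ((v + u) / 2) : ℝ) : ℂ)]

/-- The Kraus operator `A₋` of the channel `N_(u,v)`. -/
noncomputable def Aminus (u v : ℝ) : Matrix (Fin 2) (Fin 2) ℂ :=
  !![0, ((Real.sin ((v + u) / 2) : ℝ) : ℂ); ((Real.sin ((v - u) / 2) : ℝ) : ℂ), 0]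

/-- The two-parameter qubit channel `N_(u,v)` with Kraus operators `A₊`, `A₋`. -/
noncomputable def Nuv (u v : ℝ) : KrausFamily (Fin 2) (Fin 2) where
  ι := Fin 2
  K := ![Aplus u v, Aminus u v]

theorem vnEntropy_diagonal_ofReal {n : Type} [Fintype n] [DecidableEq n] (d : n → ℝ) :
    vnEntropy (Matrix.diagonal fun i => (d i : ℂ)) = -∑ i, d i * Real.logb 2 (d i) := by
  have h : (Matrix.diagonal fun i => (d i : ℂ)).IsHermitian :=
    Matrix.isHermitian_diagonal_of_self_adjoint _ (funext fun i => Complex.conj_ofReal (d i))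
  have hroots : Finset.univ.val.map (fun i => (h.eigenvalues i : ℂ)) =
      Finset.univ.val.map fun i => (d i : ℂ) := by
    have hr := h.roots_charpoly_eq_eigenvalues
    rw [Matrix.charpoly_diagonal, Polynomial.roots_prod _ _
      (Finset.prod_ne_zero_iff.mpr fun i _ => Polynomial.X_sub_C_ne_zero _)] at hr
    simpa using hr.symm
  have hmap : Finset.univ.val.map h.eigenvalues = Finset.univ.val.map d := by
    apply Multiset.map_injective Complex.ofReal_injective
    simpa only [Multiset.map_map, Function.comp_def] using hroots
  have hsum := congrArg (fun s => (s.map fun x => x * Real.logb 2 x).sum) hmap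
  simp only [Multiset.map_map] at hsum
  rw [vnEntropy, dif_pos h]
  exact congrArg Neg.neg hsum

theorem vnEntropy_eq_binEnt (x y : ℝ) (hxy : x + y = 1) :
    vnEntropy !![(x : ℂ), 0; 0, (y : ℂ)] = binEnt x := by
  have hd : !![(x : ℂ), 0; 0, (y : ℂ)] = Matrix.diagonal fun i => ((![x, y] i : ℝ) : ℂ) := by
    ext i j
    fin_cases i <;> fin_cases j <;> simp
  obtain rfl : y = 1 - x := by linarith
  rw [hd, vnEntropy_diagonal_ofReal, Fin.sum_univ_two, binEnt]
  simp only [Matrix.cons_val_zero, Matrix.cons_val_one]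
  ring

theorem half_cos_sq_add_half_sin_sq (u v : ℝ) :
    (Real.cos ((v - u) / 2) ^ 2 + Real.sin ((v + u) / 2) ^ 2) / 2 =
      (1 + Real.sin u * Real.sin v) / 2 := by
  rw [Real.cos_sq, Real.sin_sq, Real.cos_sq, mul_div_cancel₀ _ two_ne_zero,
    mul_div_cancel₀ _ two_ne_zero, Real.cos_sub, Real.cos_add]
  ring

theorem half_cos_sq_add_half_cos_sq (u v : ℝ) :
    (Real.cos ((v - u) / 2) ^ 2 + Real.cos ((v + u) / 2) ^ 2) / 2 =
      (1 + Real.cos u * Real.cos v) / 2 := by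
  rw [Real.cos_sq, Real.cos_sq, mul_div_cancel₀ _ two_ne_zero,
    mul_div_cancel₀ _ two_ne_zero, Real.cos_sub, Real.cos_add]
  ring

theorem Nuv_apply_maximally_mixed (u v : ℝ) :
    (Nuv u v).apply ((2 : ℂ)⁻¹ • 1) =
      (2 : ℂ)⁻¹ • (Aplus u v * (Aplus u v)ᴴ + Aminus u v * (Aminus u v)ᴴ) := by
  change ∑ i : Fin 2, ![Aplus u v, Aminus u v] i * _ * (![Aplus u v, Aminus u v] i)ᴴ = _
  simp [Fin.sum_univ_two]

theorem Nuv_apply_maximally_mixed_eq_diagonal (u v : ℝ) :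
    (Nuv u v).apply ((2 : ℂ)⁻¹ • 1) =
      !![(((1 + Real.sin u * Real.sin v) / 2 : ℝ) : ℂ), 0;
         0, (((1 - Real.sin u * Real.sin v) / 2 : ℝ) : ℂ)] := by
  have h₁ := half_cos_sq_add_half_sin_sq u v
  have h₂ := half_cos_sq_add_half_sin_sq (-u) v
  rw [Real.sin_neg, sub_neg_eq_add, ← sub_eq_add_neg v u, neg_mul, ← sub_eq_add_neg] at h₂
  rw [← h₁, ← h₂, Nuv_apply_maximally_mixed]
  ext i j
  fin_cases i <;> fin_cases j <;>
    simp [Aplus, Aminus, Matrix.vecMul_eq_sum, Fin.sum_univ_two, -Complex.ofReal_cos,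
      -Complex.ofReal_sin] <;> ring

theorem Nuv_compl_maximally_mixed_eq_diagonal (u v : ℝ) :
    (Nuv u v).compl ((2 : ℂ)⁻¹ • 1) =
      !![(((1 + Real.cos u * Real.cos v) / 2 : ℝ) : ℂ), 0;
         0, (((1 - Real.cos u * Real.cos v) / 2 : ℝ) : ℂ)] := by
  have h₁ := half_cos_sq_add_half_cos_sq u v
  have h₂ : (Real.sin ((v - u) / 2) ^ 2 + Real.sin ((v + u) / 2) ^ 2) / 2 =
      (1 - Real.cos u * Real.cos v) / 2 := by
    rw [Real.sin_sq, Real.sin_sq]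
    linarith
  rw [← h₁, ← h₂]
  refine Matrix.ext fun (i j : Fin 2) => ?_
  change (![Aplus u v, Aminus u v] i * _ * (![Aplus u v, Aminus u v] j)ᴴ).trace = _
  fin_cases i <;> fin_cases j <;>
    simp [Aplus, Aminus, Matrix.vecMul_eq_sum, Matrix.trace, Fin.sum_univ_two, -Complex.ofReal_cos,
      -Complex.ofReal_sin] <;> ring

/-- For all reals `u, v`: the output of `N_(u,v)` on the maximally mixed
state equals `½(A₊A₊† + A₋A₋†)` and is diagonal with eigenvalues `½(1 ± sin u sin v)`, the
complementary output `N̂_(u,v)(I/2)` is diagonal with eigenvalues `½(1 ± cos u cos v)`, and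
consequently `I^c(N_(u,v), I/2) = H(½(1 + sin u sin v)) − H(½(1 + cos u cos v))`. -/
theorem Nuv_on_maximally_mixed (u v : ℝ) :
    ((Nuv u v).apply ((2 : ℂ)⁻¹ • 1) =
      (2 : ℂ)⁻¹ • (Aplus u v * (Aplus u v)ᴴ + Aminus u v * (Aminus u v)ᴴ)) ∧
    ((Nuv u v).apply ((2 : ℂ)⁻¹ • 1) =
      !![(((1 + Real.sin u * Real.sin v) / 2 : ℝ) : ℂ), 0;
         0, (((1 - Real.sin u * Real.sin v) / 2 : ℝ) : ℂ)]) ∧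
    ((Nuv u v).compl ((2 : ℂ)⁻¹ • 1) =
      !![(((1 + Real.cos u * Real.cos v) / 2 : ℝ) : ℂ), 0;
         0, (((1 - Real.cos u * Real.cos v) / 2 : ℝ) : ℂ)]) ∧
    cohInfo (Nuv u v) ((2 : ℂ)⁻¹ • 1) =
      binEnt ((1 + Real.sin u * Real.sin v) / 2) -
      binEnt ((1 + Real.cos u * Real.cos v) / 2) := by
  refine ⟨Nuv_apply_maximally_mixed u v, Nuv_apply_maximally_mixed_eq_diagonal u v,
    Nuv_compl_maximally_mixed_eq_diagonal u v, ?_⟩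
  have hcompl : vnEntropy ((Nuv u v).compl ((2 : ℂ)⁻¹ • 1)) =
      binEnt ((1 + Real.cos u * Real.cos v) / 2) :=
    (congrArg (vnEntropy (n := Fin 2)) (Nuv_compl_maximally_mixed_eq_diagonal u v)).trans
      (vnEntropy_eq_binEnt _ _ (by ring))
  rw [cohInfo, hcompl, Nuv_apply_maximally_mixed_eq_diagonal,
    vnEntropy_eq_binEnt _ _ (by ring)]
end
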